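/- Let α, β ∈ (0,1). If g_α and g_β are both hyperbolically completely monotone, then g_{αβ} is hyperbolically completely monotone. In other words, the set of α ∈ (0,1) such that g_α is HCM is a semigroup under multiplication. -/

import Mathlib

open MeasureTheory Complex Set Filter

/-- The function `G_α` from Fourati's paper: for `z` in the slit plane,
`G_α(z) = (2πi)⁻¹ ∫_0^∞ (exp(-e^{-iπα} y^α z^{1-α}) - exp(-e^{iπα} y^α z^{1-α})) z⁻¹ e^{-y} dy`,
all complex powers being principal branches. -/
noncomputable def Galpha (α : ℝ) (z : ℂ) : ℂ :=
  (2 * Real.pi * Complex.I)⁻¹ *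
    ∫ y in Set.Ioi (0:ℝ),
      ((Complex.exp (-(Complex.exp (-(Real.pi * α : ℂ) * Complex.I)) * (y:ℂ) ^ (α:ℂ) * z ^ (1 - (α:ℂ))) -
        Complex.exp (-(Complex.exp ((Real.pi * α : ℂ) * Complex.I)) * (y:ℂ) ^ (α:ℂ) * z ^ (1 - (α:ℂ)))) / z) *
      Complex.exp (-(y:ℂ))

/-- The upper boundary value `G_α(-r^+)`. -/
noncomputable def GalphaPlus (α r : ℝ) : ℂ :=
  (2 * Real.pi * Complex.I)⁻¹ *
    ∫ y in Set.Ioi (0:ℝ),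
      ((Complex.exp ((r:ℂ) ^ (1 - (α:ℂ)) * (y:ℂ) ^ (α:ℂ)) -
        Complex.exp (Complex.exp (-(2 * Real.pi * α : ℂ) * Complex.I) * (r:ℂ) ^ (1 - (α:ℂ)) * (y:ℂ) ^ (α:ℂ))) / (r:ℂ)) *
      Complex.exp (-(y:ℂ))

/-- `θ_α(r) = -arg(G_α(-r^+))/π`. -/
noncomputable def thetaFun (α r : ℝ) : ℝ := -(GalphaPlus α r).arg / Real.pi

/-- Zolotarev's integral formula for the density of the strictly `α`-stable
distribution with positivity parameter `ρ` (the integral is a real number; we take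
the real part). -/
noncomputable def stableDensity (α ρ x : ℝ) : ℝ :=
  ((2 * Real.pi * Complex.I)⁻¹ *
    ∫ y in Set.Ioi (0:ℝ),
      ((Complex.exp (-(Complex.exp (-(Real.pi * ρ * α : ℂ) * Complex.I)) * (y:ℂ) ^ (α:ℂ) * (x:ℂ) ^ (-(α:ℂ))) -
        Complex.exp (-(Complex.exp ((Real.pi * ρ * α : ℂ) * Complex.I)) * (y:ℂ) ^ (α:ℂ) * (x:ℂ) ^ (-(α:ℂ)))) / (x:ℂ)) *
      Complex.exp (-(y:ℂ))).re

/-- A function is completely monotone (on `(0,∞)`) if it is infinitely differentiable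
there and `(-1)^n f^{(n)}(x) ≥ 0` for all `n` and `x > 0`. -/
def CompletelyMonotone (φ : ℝ → ℝ) : Prop :=
  ContDiffOn ℝ (⊤ : ℕ∞) φ (Set.Ioi 0) ∧
  ∀ (n : ℕ) (x : ℝ), 0 < x → 0 ≤ (-1 : ℝ) ^ n * iteratedDeriv n φ x

/-- A function `H` on `(0,∞)` is hyperbolically completely monotone if for every `u > 0`
the function `v ↦ H(uv)H(u/v)` is a completely monotone function of `v + 1/v`. -/
def HCM (H : ℝ → ℝ) : Prop :=
  ∀ u : ℝ, 0 < u → ∃ φ : ℝ → ℝ, CompletelyMonotone φ ∧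
    ∀ v : ℝ, 0 < v → H (u * v) * H (u / v) = φ (v + 1 / v)

open scoped Topology ContDiff

/-- Nonnegativity on `(a, ∞)` of all alternating differences of order at most `n`. -/
def AltDiff (a : ℝ) : ℕ → (ℝ → ℝ) → Prop
  | 0, f => ∀ x, a < x → 0 ≤ f x
  | n + 1, f => AltDiff a n f ∧ ∀ h, 0 < h → AltDiff a n (fun x => f x - f (x + h))

/-- Nonnegativity on `(a, ∞)` of the first `n` derivatives, with alternating signs. -/
def AltDeriv (a : ℝ) : ℕ → (ℝ → ℝ) → Prop
  | 0, f => ∀ x, a < x → 0 ≤ f x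
  | n + 1, f => (∀ x, a < x → 0 ≤ f x) ∧
      ∃ df : ℝ → ℝ, (∀ x, a < x → HasDerivAt f (-df x) x) ∧ AltDeriv a n df

/-- Complete monotonicity on `(a, ∞)`. -/
def CMOn (a : ℝ) (f : ℝ → ℝ) : Prop :=
  ContDiffOn ℝ ∞ f (Ioi a) ∧ ∀ (n : ℕ) (x : ℝ), a < x → 0 ≤ (-1 : ℝ) ^ n * iteratedDeriv n f x

namespace AltDiff

variable {a : ℝ} {n : ℕ} {f g : ℝ → ℝ}

theorem congr (hf : AltDiff a n f) (h : EqOn f g (Ioi a)) : AltDiff a n g := by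
  induction n generalizing f g with
  | zero => intro x hx; rw [← h hx]; exact hf x hx
  | succ n ih =>
    refine ⟨ih hf.1 h, fun k hk => ih (hf.2 k hk) fun x hx => ?_⟩
    have hx' : x + k ∈ Ioi a := by simp only [mem_Ioi] at hx ⊢; linarith
    simp only [h hx, h hx']

theorem of_tendsto {ι : Type*} {l : Filter ι} [l.NeBot] {F : ι → ℝ → ℝ}
    (hF : ∀ i, AltDiff a n (F i))
    (h : ∀ x, a < x → Tendsto (fun i => F i x) l (𝓝 (f x))) : AltDiff a n f := by
  induction n generalizing f F with
  | zero => intro x hx; exact ge_of_tendsto' (h x hx) fun i => hF i x hx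
  | succ n ih =>
    exact ⟨ih (fun i => (hF i).1) h, fun k hk => ih (fun i => (hF i).2 k hk)
      fun x hx => (h x hx).sub (h (x + k) (by linarith))⟩

theorem of_eventually_tendsto {ι : Type*} {l : Filter ι} [l.NeBot] {F : ι → ℝ → ℝ}
    (hF : ∀ᶠ i in l, AltDiff a n (F i))
    (h : ∀ x, a < x → Tendsto (fun i => F i x) l (𝓝 (f x))) : AltDiff a n f := by
  induction n generalizing f F with
  | zero => intro x hx; exact ge_of_tendsto (h x hx) (hF.mono fun i hi => hi x hx)
  | succ n ih =>
    exact ⟨ih (hF.mono fun i hi => hi.1) h, fun k hk => ih (hF.mono fun i hi => hi.2 k hk)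
      fun x hx => (h x hx).sub (h (x + k) (by linarith))⟩

theorem integral {X : Type*} [MeasurableSpace X] {μ : Measure X} {F : X → ℝ → ℝ}
    (hF : ∀ s, AltDiff a n (F s)) (hi : ∀ x, a < x → Integrable (fun s => F s x) μ) :
    AltDiff a n (fun x => ∫ s, F s x ∂μ) := by
  induction n generalizing F with
  | zero => intro x hx; exact integral_nonneg fun s => hF s x hx
  | succ n ih =>
    refine ⟨ih (fun s => (hF s).1) hi, fun k hk => ?_⟩
    refine (ih (fun s => (hF s).2 k hk)
      fun x hx => (hi x hx).sub (hi (x + k) (by linarith))).congr fun x hx => ?_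
    have hx' : a < x + k := by simp only [mem_Ioi] at hx; linarith
    exact integral_sub (hi x hx) (hi (x + k) hx')

theorem add (hf : AltDiff a n f) (hg : AltDiff a n g) : AltDiff a n (fun x => f x + g x) := by
  induction n generalizing f g with
  | zero => intro x hx; exact add_nonneg (hf x hx) (hg x hx)
  | succ n ih =>
    refine ⟨ih hf.1 hg.1, fun k hk => (ih (hf.2 k hk) (hg.2 k hk)).congr fun x _ => ?_⟩
    ring

theorem const_mul (hf : AltDiff a n f) {c : ℝ} (hc : 0 ≤ c) :
    AltDiff a n (fun x => c * f x) := by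
  induction n generalizing f with
  | zero => intro x hx; exact mul_nonneg hc (hf x hx)
  | succ n ih =>
    refine ⟨ih hf.1, fun k hk => (ih (hf.2 k hk)).congr fun x _ => ?_⟩
    ring

theorem zero : AltDiff a n (fun _ => 0) := by
  induction n with
  | zero => intro x _; exact le_rfl
  | succ n ih => exact ⟨ih, fun k _ => by simpa using ih⟩

theorem sum {ι : Type*} (s : Finset ι) {F : ι → ℝ → ℝ} (hF : ∀ i ∈ s, AltDiff a n (F i)) :
    AltDiff a n (fun x => ∑ i ∈ s, F i x) := by
  classical
  induction s using Finset.induction_on with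
  | empty => simpa using zero
  | insert i s hi ih =>
    simp only [Finset.sum_insert hi]
    exact (hF i (Finset.mem_insert_self i s)).add
      (ih fun j hj => hF j (Finset.mem_insert_of_mem hj))

theorem exp_neg {c l : ℝ} (hc : 0 ≤ c) (hl : 0 ≤ l) :
    AltDiff a n (fun x => c * Real.exp (-(l * x))) := by
  induction n generalizing c with
  | zero => intro x _; positivity
  | succ n ih =>
    refine ⟨ih hc, fun k hk => ?_⟩
    have h1 : Real.exp (-(l * k)) ≤ 1 := Real.exp_le_one_iff.2 (by nlinarith)
    refine (ih (c := c * (1 - Real.exp (-(l * k)))) (mul_nonneg hc (by linarith))).congr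
      fun x _ => ?_
    have : Real.exp (-(l * (x + k))) = Real.exp (-(l * x)) * Real.exp (-(l * k)) := by
      rw [← Real.exp_add]; ring_nf
    simp only [this]; ring

theorem neg_deriv (hf : AltDiff a (n + 1) f) {f' : ℝ → ℝ}
    (h : ∀ x, a < x → HasDerivAt f (-f' x) x) : AltDiff a n f' := by
  have hF : ∀ᶠ k in 𝓝[>] (0 : ℝ), AltDiff a n (fun x => k⁻¹ * (f x - f (x + k))) := by
    filter_upwards [self_mem_nhdsWithin] with k hk
    exact (hf.2 k hk).const_mul (inv_nonneg.2 (le_of_lt hk))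
  refine of_eventually_tendsto hF fun x hx => ?_
  have h1 := ((h x hx).tendsto_slope_zero_right).neg
  simp only [neg_neg] at h1
  refine h1.congr fun k => ?_
  simp only [smul_eq_mul]; ring

theorem altDeriv {f : ℝ → ℝ} (hs : ContDiffOn ℝ ∞ f (Ioi a)) (hf : ∀ n, AltDiff a n f) (n : ℕ) :
    AltDeriv a n f := by
  induction n generalizing f with
  | zero => exact hf 0
  | succ n ih =>
    have hd : ∀ x, a < x → HasDerivAt f (-(-deriv f x)) x := fun x hx => by
      rw [neg_neg]
      exact ((hs.differentiableOn (by simp)).differentiableAt (Ioi_mem_nhds hx)).hasDerivAt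
    refine ⟨hf 0, fun x => -deriv f x, hd, ih ?_ fun m => (hf (m + 1)).neg_deriv hd⟩
    exact ((contDiffOn_infty_iff_deriv_of_isOpen isOpen_Ioi).1 hs).2.neg

end AltDiff

namespace AltDeriv

variable {a : ℝ} {n : ℕ} {f g : ℝ → ℝ}

theorem of_succ (hf : AltDeriv a (n + 1) f) : AltDeriv a n f := by
  induction n generalizing f with
  | zero => exact hf.1
  | succ n ih =>
    obtain ⟨h0, f', hd, hf'⟩ := hf
    exact ⟨h0, f', hd, ih hf'⟩

theorem add (hf : AltDeriv a n f) (hg : AltDeriv a n g) : AltDeriv a n (fun x => f x + g x) := by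
  induction n generalizing f g with
  | zero => intro x hx; exact add_nonneg (hf x hx) (hg x hx)
  | succ n ih =>
    obtain ⟨h0, f', hd, hf'⟩ := hf
    obtain ⟨k0, g', kd, hg'⟩ := hg
    refine ⟨fun x hx => add_nonneg (h0 x hx) (k0 x hx), _, fun x hx => ?_, ih hf' hg'⟩
    exact ((hd x hx).add (kd x hx)).congr_deriv (by ring)

theorem mul (hf : AltDeriv a n f) (hg : AltDeriv a n g) : AltDeriv a n (fun x => f x * g x) := by
  induction n generalizing f g with
  | zero => intro x hx; exact mul_nonneg (hf x hx) (hg x hx)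
  | succ n ih =>
    have hf0 := hf.of_succ
    have hg0 := hg.of_succ
    obtain ⟨h0, f', hd, hf'⟩ := hf
    obtain ⟨k0, g', kd, hg'⟩ := hg
    refine ⟨fun x hx => mul_nonneg (h0 x hx) (k0 x hx), _, fun x hx => ?_,
      (ih hf' hg0).add (ih hf0 hg')⟩
    exact ((hd x hx).mul (kd x hx)).congr_deriv (by ring)

/-- A function with alternating derivatives composed with a Bernstein function. -/
theorem comp {B B' : ℝ → ℝ} {c : ℝ} (hf : AltDeriv c n f) (hB : ∀ x, a < x → c < B x)
    (hd : ∀ x, a < x → HasDerivAt B (B' x) x) (hB' : ∀ m, AltDeriv a m B') :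
    AltDeriv a n (fun x => f (B x)) := by
  induction n generalizing f with
  | zero => intro x hx; exact hf _ (hB x hx)
  | succ n ih =>
    obtain ⟨h0, f', kd, hf'⟩ := hf
    refine ⟨fun x hx => h0 _ (hB x hx), _, fun x hx => ?_, (ih hf').mul (hB' n)⟩
    exact ((kd _ (hB x hx)).comp x (hd x hx)).congr_deriv (by ring)

theorem sign_iteratedDeriv (hf : AltDeriv a n f) {x : ℝ} (hx : a < x) :
    0 ≤ (-1 : ℝ) ^ n * iteratedDeriv n f x := by
  induction n generalizing f with
  | zero => simpa using hf x hx
  | succ n ih =>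
    obtain ⟨h0, f', kd, hf'⟩ := hf
    have : deriv f =ᶠ[𝓝 x] -f' := by
      filter_upwards [Ioi_mem_nhds hx] with y hy using (kd y hy).deriv
    rw [iteratedDeriv_succ', this.iteratedDeriv_eq, iteratedDeriv_neg, pow_succ]
    simpa using ih hf'

end AltDeriv

theorem CMOn.altDeriv {a : ℝ} {f : ℝ → ℝ} (hf : CMOn a f) (n : ℕ) : AltDeriv a n f := by
  induction n generalizing f with
  | zero => intro x hx; simpa using hf.2 0 x hx
  | succ n ih =>
    refine ⟨fun x hx => by simpa using hf.2 0 x hx, fun x => -deriv f x, fun x hx => ?_, ih ?_⟩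
    · rw [neg_neg]
      exact ((hf.1.differentiableOn (by simp)).differentiableAt (Ioi_mem_nhds hx)).hasDerivAt
    · refine ⟨((contDiffOn_infty_iff_deriv_of_isOpen isOpen_Ioi).1 hf.1).2.neg, fun m x hx => ?_⟩
      have := hf.2 (m + 1) x hx
      rw [iteratedDeriv_succ', pow_succ] at this
      have h2 : iteratedDeriv m (fun y => -deriv f y) x = -iteratedDeriv m (deriv f) x :=
        iteratedDeriv_fun_neg ..
      rw [h2]; linarith

theorem CMOn.of_altDiff {a : ℝ} {f : ℝ → ℝ} (hs : ContDiffOn ℝ ∞ f (Ioi a))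
    (hf : ∀ n, AltDiff a n f) : CMOn a f :=
  ⟨hs, fun n _ hx => (AltDiff.altDeriv hs hf n).sign_iteratedDeriv hx⟩

theorem CMOn.comp {a c : ℝ} {f B B' : ℝ → ℝ} (hf : CMOn c f) (hs : ContDiffOn ℝ ∞ B (Ioi a))
    (hB : ∀ x, a < x → c < B x) (hd : ∀ x, a < x → HasDerivAt B (B' x) x)
    (hB' : CMOn a B') : CMOn a (fun x => f (B x)) :=
  ⟨hf.1.comp hs hB, fun n _ hx =>
    ((hf.altDeriv n).comp hB hd hB'.altDeriv).sign_iteratedDeriv hx⟩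

theorem CMOn.nonneg {a : ℝ} {f : ℝ → ℝ} (hf : CMOn a f) {x : ℝ} (hx : a < x) : 0 ≤ f x :=
  hf.altDeriv 0 x hx

theorem CMOn.antitoneOn {a : ℝ} {f : ℝ → ℝ} (hf : CMOn a f) : AntitoneOn f (Ioi a) := by
  refine antitoneOn_of_deriv_nonpos (convex_Ioi a) hf.1.continuousOn
    ((hf.1.differentiableOn (by simp)).mono interior_subset) fun x hx => ?_
  have := hf.2 1 x (by simpa using hx)
  rw [iteratedDeriv_one] at this
  linarith

theorem CMOn.mono {a b : ℝ} {f : ℝ → ℝ} (hf : CMOn a f) (hab : a ≤ b) : CMOn b f :=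
  ⟨hf.1.mono (Ioi_subset_Ioi hab), fun n x hx => hf.2 n x (hab.trans_lt hx)⟩

theorem CMOn.const_mul {a c : ℝ} {f : ℝ → ℝ} (hf : CMOn a f) (hc : 0 ≤ c) :
    CMOn a (fun x => c * f x) := by
  refine ⟨contDiffOn_const.mul hf.1, fun n x hx => ?_⟩
  rw [iteratedDeriv_const_mul_field]
  have := mul_nonneg hc (hf.2 n x hx)
  linarith

/-- The Taylor remainder of order `n` at `c` of the function `y ↦ f (c - y)`. -/
noncomputable def revTaylorRemainder (f : ℝ → ℝ) (c : ℝ) (n : ℕ) (y : ℝ) : ℝ :=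
  f (c - y) - ∑ k ∈ Finset.range (n + 1),
    (-1 : ℝ) ^ k * iteratedDeriv k f c / (k.factorial : ℝ) * y ^ k

theorem CMOn.revTaylorRemainder_eq {a c y : ℝ} {f : ℝ → ℝ} (hf : CMOn a f) (n : ℕ) (hy : 0 < y)
    (hyc : a < c - y) :
    revTaylorRemainder f c n y = ∫ t in (0 : ℝ)..y, (y - t) ^ n / (n.factorial : ℝ) *
      ((-1 : ℝ) ^ (n + 1) * iteratedDeriv (n + 1) f (c - t)) := by
  have hmem : ∀ t ∈ uIcc 0 y, a < c - t := by
    intro t ht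
    rw [uIcc_of_le hy.le] at ht
    linarith [ht.2]
  have hat : ∀ t ∈ uIcc 0 y, ContDiffAt ℝ ∞ (fun z => f (c - z)) t := fun t ht => by
    have h1 : ContDiffAt ℝ ∞ f (c - t) := hf.1.contDiffAt (Ioi_mem_nhds (hmem t ht))
    exact h1.comp t (contDiffAt_const.sub contDiffAt_id)
  have hder : ∀ (k : ℕ), ∀ t ∈ uIcc 0 y, iteratedDerivWithin k (fun z => f (c - z)) (uIcc 0 y) t
      = (-1 : ℝ) ^ k * iteratedDeriv k f (c - t) := fun k t ht => by
    rw [iteratedDerivWithin_eq_iteratedDeriv (uniqueDiffOn_uIcc hy.ne)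
      ((hat t ht).of_le (by exact_mod_cast le_top)) ht, iteratedDeriv_comp_const_sub]
    simp
  have key := taylor_integral_remainder (f := fun z => f (c - z)) (x₀ := 0) (x := y) (n := n)
    fun t ht => ((hat t ht).of_le (by exact_mod_cast le_top)).contDiffWithinAt
  rw [taylor_within_apply] at key
  rw [revTaylorRemainder]
  convert key using 1
  · congr 1
    refine Finset.sum_congr rfl fun k _ => ?_
    rw [hder k 0 left_mem_uIcc]
    simp only [sub_zero, smul_eq_mul]
    field_simp
  · refine intervalIntegral.integral_congr fun t ht => ?_
    simp only [hder (n + 1) t ht, smul_eq_mul]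

theorem CMOn.revTaylorRemainder_nonneg {a c y : ℝ} {f : ℝ → ℝ} (hf : CMOn a f) (n : ℕ)
    (hy : 0 < y) (hyc : a < c - y) : 0 ≤ revTaylorRemainder f c n y := by
  rw [hf.revTaylorRemainder_eq n hy hyc]
  refine intervalIntegral.integral_nonneg hy.le fun t ht => ?_
  have h1 : 0 ≤ y - t := by linarith [ht.2]
  have h2 := hf.2 (n + 1) (c - t) (by linarith [ht.2])
  positivity

theorem CMOn.revTaylorRemainder_le {a c y z : ℝ} {f : ℝ → ℝ} (hf : CMOn a f) (n : ℕ)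
    (hy : 0 < y) (hyz : y ≤ z) (hz : a < c - z) :
    revTaylorRemainder f c n y ≤ (y / z) ^ n * revTaylorRemainder f c n z := by
  have hz0 : 0 < z := hy.trans_le hyz
  rw [hf.revTaylorRemainder_eq n hy (by linarith), hf.revTaylorRemainder_eq n hz0 hz,
    ← intervalIntegral.integral_const_mul]
  set G : ℝ → ℝ := fun t => (-1 : ℝ) ^ (n + 1) * iteratedDeriv (n + 1) f (c - t) with hG
  have hGc : ContinuousOn G (Icc 0 z) := by
    have h1 : ContinuousOn (iteratedDeriv (n + 1) f) (Ioi a) :=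
      (hf.1.continuousOn_iteratedDerivWithin (m := n + 1) (by exact_mod_cast le_top)
        isOpen_Ioi.uniqueDiffOn).congr fun x hx =>
          (iteratedDerivWithin_of_isOpen isOpen_Ioi hx).symm
    refine continuousOn_const.mul (h1.comp (by fun_prop) fun t ht => ?_)
    simp only [mem_Ioi]; linarith [ht.2]
  have hG0 : ∀ t ∈ Icc 0 z, 0 ≤ G t := fun t ht => hf.2 (n + 1) _ (by linarith [ht.2])
  have hi2 : IntervalIntegrable (fun t => (y / z) ^ n * ((z - t) ^ n / (n.factorial : ℝ) * G t))
      volume 0 z := by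
    apply ContinuousOn.intervalIntegrable
    rw [uIcc_of_le hz0.le]
    exact continuousOn_const.mul ((Continuous.continuousOn (by fun_prop)).mul hGc)
  have hi1 : IntervalIntegrable (fun t => (y - t) ^ n / (n.factorial : ℝ) * G t) volume 0 y := by
    apply ContinuousOn.intervalIntegrable
    rw [uIcc_of_le hy.le]
    exact (Continuous.continuousOn (by fun_prop)).mul (hGc.mono (Icc_subset_Icc_right hyz))
  have hsub : uIcc 0 y ⊆ uIcc 0 z := by
    rw [uIcc_of_le hy.le, uIcc_of_le hz0.le]; exact Icc_subset_Icc_right hyz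
  calc ∫ t in (0 : ℝ)..y, (y - t) ^ n / (n.factorial : ℝ) * G t
      ≤ ∫ t in (0 : ℝ)..y, (y / z) ^ n * ((z - t) ^ n / (n.factorial : ℝ) * G t) := by
        refine intervalIntegral.integral_mono_on hy.le hi1 (hi2.mono_set hsub) fun t ht => ?_
        have h1 : y - t ≤ y / z * (z - t) := by
          have : y / z ≤ 1 := (div_le_one hz0).2 hyz
          have h3 : y / z * z = y := by field_simp
          nlinarith [ht.1]
        have h2 := pow_le_pow_left₀ (by linarith [ht.2]) h1 n
        rw [mul_pow] at h2
        have h4 := hG0 t ⟨ht.1, ht.2.trans hyz⟩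
        calc (y - t) ^ n / (n.factorial : ℝ) * G t
            ≤ (y / z) ^ n * (z - t) ^ n / (n.factorial : ℝ) * G t := by gcongr
          _ = _ := by ring
    _ ≤ _ := by
        refine intervalIntegral.integral_mono_interval le_rfl hy.le hyz ?_ hi2
        refine (ae_restrict_iff' measurableSet_Ioc).2 (Eventually.of_forall fun t ht => ?_)
        have h4 := hG0 t ⟨ht.1.le, ht.2⟩
        have h5 : 0 ≤ z - t := by linarith [ht.2]
        simp only [Pi.zero_apply]
        positivity

theorem tendsto_mul_one_sub_exp (z : ℝ) :
    Tendsto (fun M : ℕ => ((M : ℝ) + 1) * (1 - Real.exp (-(z / ((M : ℝ) + 1))))) atTop (𝓝 z) := by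
  have h1 : HasDerivAt (fun s : ℝ => -Real.exp (-(z * s))) z 0 := by
    have := (((hasDerivAt_id (0 : ℝ)).const_mul z).fun_neg.exp).fun_neg
    simpa using this
  have h2 := h1.tendsto_slope_zero_right
  have h3 : Tendsto (fun M : ℕ => 1 / ((M : ℝ) + 1)) atTop (𝓝[>] 0) :=
    tendsto_nhdsWithin_iff.2 ⟨tendsto_one_div_add_atTop_nhds_zero_nat,
      Eventually.of_forall fun M => by simp only [mem_Ioi]; positivity⟩
  refine (h2.comp h3).congr fun M => ?_
  simp only [Function.comp, smul_eq_mul, zero_add, mul_zero, neg_zero, Real.exp_zero]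
  rw [one_div, inv_inv, ← div_eq_mul_inv]
  ring

/-- Bounded completely monotone functions are pointwise limits of uniformly bounded nonnegative
combinations of decaying exponentials. -/
theorem CMOn.exists_exp_approx {a C : ℝ} {f : ℝ → ℝ} (hf : CMOn a f)
    (hC : ∀ x, a < x → f x ≤ C) :
    ∃ (m : ℕ → ℕ) (d l : ℕ → ℕ → ℝ), (∀ M k, 0 ≤ d M k) ∧ (∀ M k, 0 ≤ l M k) ∧
      (∀ M x, a < x → ∑ k ∈ Finset.range (m M), d M k * Real.exp (-(l M k * x)) ≤ C) ∧
      ∀ x, a < x → Tendsto (fun M => ∑ k ∈ Finset.range (m M),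
        d M k * Real.exp (-(l M k * x))) atTop (𝓝 (f x)) := by
  let N : ℕ → ℝ := fun M => (M : ℝ) + 1
  have hN : ∀ M, 0 < N M := fun M => by positivity
  let d : ℕ → ℕ → ℝ := fun M k => (-1 : ℝ) ^ k * iteratedDeriv k f (a + N M) /
    (k.factorial : ℝ) * (N M) ^ k * Real.exp (k * a / N M)
  let l : ℕ → ℕ → ℝ := fun M k => k / N M
  let m : ℕ → ℕ := fun M => (M + 1) ^ 2 + 1
  let Y : ℕ → ℝ → ℝ := fun M z => N M * Real.exp (-(z / N M))
  have hY : ∀ M z, 0 < Y M z := fun M z => mul_pos (hN M) (Real.exp_pos _)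
  have hYN : ∀ M z, 0 < z → a < a + N M - Y M z := fun M z hz => by
    have : Real.exp (-(z / N M)) < 1 := by
      rw [Real.exp_lt_one_iff]; linarith [div_pos hz (hN M)]
    have : Y M z < N M := by
      calc N M * Real.exp (-(z / N M)) < N M * 1 := by gcongr
        _ = _ := mul_one _
    linarith
  have hS : ∀ M x, ∑ k ∈ Finset.range (m M), d M k * Real.exp (-(l M k * x)) =
      f (a + N M - Y M (x - a)) -
        revTaylorRemainder f (a + N M) ((M + 1) ^ 2) (Y M (x - a)) := fun M x => by
    rw [revTaylorRemainder, sub_sub_cancel]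
    refine Finset.sum_congr rfl fun k _ => ?_
    have : Y M (x - a) ^ k = N M ^ k * (Real.exp (k * a / N M) * Real.exp (-(l M k * x))) := by
      simp only [Y, mul_pow, ← Real.exp_nat_mul, ← Real.exp_add, l]
      congr 2; ring
    rw [this]; simp only [d]; ring
  refine ⟨m, d, l, fun M k => ?_, fun M k => div_nonneg (Nat.cast_nonneg _) (hN M).le,
    fun M x hx => ?_, fun x hx => ?_⟩
  · have := hf.2 k (a + N M) (by linarith [hN M])
    have := (hN M).le
    positivity
  · rw [hS]
    have := hf.revTaylorRemainder_nonneg ((M + 1) ^ 2) (hY M (x - a)) (hYN M (x - a) (by linarith))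
    linarith [hC _ (hYN M (x - a) (by linarith))]
  · simp only [hS]
    have hz : 0 < x - a := by linarith
    have h1 : Tendsto (fun M => f (a + N M - Y M (x - a))) atTop (𝓝 (f x)) := by
      have hc : ContinuousAt f x := (hf.1.continuousOn).continuousAt (Ioi_mem_nhds hx)
      refine hc.tendsto.comp ?_
      have := (tendsto_mul_one_sub_exp (x - a)).const_add a
      rw [add_sub_cancel] at this
      refine this.congr fun M => ?_
      simp only [Y, N]; ring
    have h2 : Tendsto (fun M => revTaylorRemainder f (a + N M) ((M + 1) ^ 2) (Y M (x - a)))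
        atTop (𝓝 0) := by
      have h3 : Tendsto (fun M : ℕ => Real.exp (-((x - a) / 2 * N M)) * C) atTop (𝓝 0) := by
        rw [← zero_mul C]
        refine Tendsto.mul_const _ (Real.tendsto_exp_atBot.comp ?_)
        refine tendsto_neg_atTop_atBot.comp (Tendsto.const_mul_atTop (by linarith) ?_)
        exact tendsto_natCast_atTop_atTop.atTop_add tendsto_const_nhds
      refine squeeze_zero (fun M => hf.revTaylorRemainder_nonneg _ (hY M _) (hYN M _ hz))
        (fun M => ?_) h3
      have hle : Y M (x - a) ≤ Y M ((x - a) / 2) := by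
        simp only [Y]
        have := (hN M).le
        gcongr
        linarith
      refine (hf.revTaylorRemainder_le ((M + 1) ^ 2) (hY M _) hle
        (hYN M _ (by linarith))).trans ?_
      have h4 : (Y M (x - a) / Y M ((x - a) / 2)) ^ ((M + 1) ^ 2) =
          Real.exp (-((x - a) / 2 * N M)) := by
        simp only [Y]
        rw [mul_div_mul_left _ _ (hN M).ne', ← Real.exp_sub, ← Real.exp_nat_mul]
        congr 1
        push_cast
        have := (hN M).ne'
        simp only [N] at this ⊢
        field_simp
        ring
      rw [h4]
      refine mul_le_mul_of_nonneg_left ?_ (Real.exp_pos _).le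
      have h5 : revTaylorRemainder f (a + N M) ((M + 1) ^ 2) (Y M ((x - a) / 2)) ≤
          f (a + N M - Y M ((x - a) / 2)) := by
        rw [revTaylorRemainder]
        refine sub_le_self _ (Finset.sum_nonneg fun k _ => ?_)
        have := hf.2 k (a + N M) (by linarith [hN M])
        have := (hY M ((x - a) / 2)).le
        positivity
      exact h5.trans (hC _ (hYN M _ (by linarith)))
    simpa using h1.sub h2

/-- The larger root `v` of `v + 1 / v = w`. -/
noncomputable def joukowskiInv (w : ℝ) : ℝ := (w + √(w ^ 2 - 4)) / 2

theorem one_lt_joukowskiInv {w : ℝ} (hw : 2 < w) : 1 < joukowskiInv w := by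
  rw [joukowskiInv]
  linarith [Real.sqrt_nonneg (w ^ 2 - 4)]

theorem joukowskiInv_pos {w : ℝ} (hw : 2 < w) : 0 < joukowskiInv w :=
  one_pos.trans (one_lt_joukowskiInv hw)

theorem joukowskiInv_add_inv {w : ℝ} (hw : 2 < w) :
    joukowskiInv w + 1 / joukowskiInv w = w := by
  have h0 := joukowskiInv_pos hw
  have h1 : √(w ^ 2 - 4) ^ 2 = w ^ 2 - 4 := Real.sq_sqrt (by nlinarith)
  field_simp
  rw [joukowskiInv]
  linear_combination h1 / 4

theorem two_lt_add_inv {v : ℝ} (hv : 0 < v) (h1 : v ≠ 1) : 2 < v + 1 / v := by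
  have : 0 < (v - 1) ^ 2 := by have := sub_ne_zero.2 h1; positivity
  have h2 : v + 1 / v - 2 = (v - 1) ^ 2 / v := by field_simp; ring
  have := div_pos this hv
  linarith

theorem sq_le_exp_add_exp_neg (t : ℝ) : t ^ 2 / 2 ≤ Real.exp t + Real.exp (-t) := by
  rcases le_total 0 t with h | h
  · linarith [Real.quadratic_le_exp_of_nonneg h, Real.exp_pos (-t)]
  · have := Real.quadratic_le_exp_of_nonneg (neg_nonneg.2 h)
    nlinarith [Real.exp_pos t]

theorem integrable_exp_neg_add_exp {A B : ℝ} (hA : 0 < A) (hB : 0 < B) :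
    Integrable (fun t : ℝ => Real.exp (-(A * Real.exp t + B * Real.exp (-t)))) := by
  have hm : 0 < min A B := lt_min hA hB
  refine (integrable_exp_neg_mul_sq (b := min A B / 2) (by positivity)).mono'
    (by fun_prop) (Eventually.of_forall fun t => ?_)
  rw [Real.norm_of_nonneg (Real.exp_pos _).le]
  gcongr
  have h1 := mul_le_mul_of_nonneg_left (sq_le_exp_add_exp_neg t) hm.le
  nlinarith [min_le_left A B, min_le_right A B, Real.exp_pos t, Real.exp_pos (-t)]

theorem integral_exp_neg_add_exp {A : ℝ} (B : ℝ) (hA : 0 < A) :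
    ∫ t : ℝ, Real.exp (-(A * Real.exp t + B * Real.exp (-t))) =
      ∫ t : ℝ, Real.exp (-(Real.exp t + A * B * Real.exp (-t))) := by
  rw [← integral_add_right_eq_self (fun t : ℝ => Real.exp (-(Real.exp t + A * B * Real.exp (-t))))
    (Real.log A)]
  congr 1
  ext t
  rw [neg_add t, Real.exp_add t, Real.exp_add (-t), Real.exp_neg (Real.log A), Real.exp_log hA]
  congr 2
  field_simp

/-- The hyperbolic convolution of two exponentials is completely monotone. -/
theorem altDiff_integral_exp_kernel {l m : ℝ} (hl : 0 < l) (hm : 0 < m) (n : ℕ) :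
    AltDiff 2 n (fun w => ∫ t : ℝ, Real.exp (-(l * (joukowskiInv w * Real.exp (-t) +
      Real.exp t / joukowskiInv w) + m * (Real.exp t + Real.exp (-t))))) := by
  have key : AltDiff 2 n (fun w => ∫ t : ℝ,
      Real.exp (-(Real.exp t + (l ^ 2 + m ^ 2) * Real.exp (-t))) *
        Real.exp (-((l * m * Real.exp (-t)) * w))) := by
    refine AltDiff.integral (fun t => AltDiff.exp_neg (by positivity) (by positivity))
      fun w hw => ?_
    refine (integrable_exp_neg_add_exp one_pos (B := l ^ 2 + m ^ 2 + l * m * w)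
      (by positivity)).congr (Eventually.of_forall fun t => ?_)
    simp only [← Real.exp_add]
    congr 1; ring
  refine key.congr fun w hw => ?_
  have hv := joukowskiInv_pos hw
  have hvw := joukowskiInv_add_inv hw
  set v := joukowskiInv w
  have h1 := integral_exp_neg_add_exp (A := l / v + m) (l * v + m) (by positivity)
  beta_reduce
  calc _ = ∫ t : ℝ, Real.exp (-(Real.exp t + (l / v + m) * (l * v + m) * Real.exp (-t))) := by
        congr 1; ext t
        rw [← Real.exp_add]
        congr 1
        have : (l / v + m) * (l * v + m) = l ^ 2 + m ^ 2 + l * m * w := by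
          rw [← hvw]; field_simp; ring
        rw [this]; ring
    _ = _ := by
        rw [← h1]
        congr 1; ext t
        congr 1; ring

/-- The hyperbolic convolution of two bounded completely monotone functions is completely
monotone. -/
theorem altDiff_integral_kernel {f g : ℝ → ℝ} {C D : ℝ} (hf : CMOn 2 f) (hg : CMOn 2 g)
    (hC : ∀ x, 2 < x → f x ≤ C) (hD : ∀ x, 2 < x → g x ≤ D)
    (hi : ∀ w, 2 < w → Integrable (fun t : ℝ => f (joukowskiInv w * Real.exp (-t) +
      Real.exp t / joukowskiInv w) * g (Real.exp t + Real.exp (-t)))) (n : ℕ) :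
    AltDiff 2 n (fun w => ∫ t : ℝ, f (joukowskiInv w * Real.exp (-t) +
      Real.exp t / joukowskiInv w) * g (Real.exp t + Real.exp (-t))) := by
  let X : ℝ → ℝ → ℝ := fun w t => joukowskiInv w * Real.exp (-t) + Real.exp t / joukowskiInv w
  let Y : ℝ → ℝ := fun t => Real.exp t + Real.exp (-t)
  have hX : ∀ w, 2 < w → ∀ᵐ t : ℝ, 2 < X w t := fun w hw => by
    have hv := joukowskiInv_pos hw
    filter_upwards [compl_mem_ae_iff.2 (measure_singleton (Real.log (joukowskiInv w)))] with t ht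
    have := two_lt_add_inv (v := joukowskiInv w * Real.exp (-t)) (by positivity) fun h => by
      apply ht
      rw [Real.exp_neg, mul_inv_eq_one₀ (Real.exp_pos t).ne'] at h
      rw [mem_singleton_iff, h, Real.log_exp]
    simp only [X]
    convert this using 2
    rw [Real.exp_neg]; field_simp
  have hY : ∀ᵐ t : ℝ, 2 < Y t := by
    filter_upwards [compl_mem_ae_iff.2 (measure_singleton (0 : ℝ))] with t ht
    have := two_lt_add_inv (Real.exp_pos t) fun h => ht (by simpa using h)
    simpa [Y, Real.exp_neg] using this
  have hX0 : ∀ w, 2 < w → ∀ t, 0 < X w t := fun w hw t => by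
    have := joukowskiInv_pos hw; positivity
  have hY0 : ∀ t, 0 < Y t := fun t => by positivity
  have hdom : ∀ e : ℝ, 0 < e → ∀ w, 2 < w →
      Integrable (fun t => Real.exp (-(e * (X w t + Y t)))) := fun e he w hw => by
    have hv := joukowskiInv_pos hw
    refine (integrable_exp_neg_add_exp (A := e * (1 / joukowskiInv w + 1))
      (B := e * (joukowskiInv w + 1)) (by positivity) (by positivity)).congr
      (Eventually.of_forall fun t => ?_)
    simp only [X, Y]
    congr 1; ring
  obtain ⟨p, c, l, hc, hl, hcC, hcf⟩ := hf.exists_exp_approx hC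
  obtain ⟨q, d, m, hd, hm, hdD, hdg⟩ := hg.exists_exp_approx hD
  have hC0 : 0 ≤ C := (hf.nonneg (x := 3) (by norm_num)).trans (hC 3 (by norm_num))
  have step1 : ∀ e : ℝ, 0 < e → AltDiff 2 n (fun w => ∫ t : ℝ,
      Real.exp (-(e * (X w t + Y t))) * (f (X w t) * g (Y t))) := fun e he => by
    refine AltDiff.of_tendsto (l := atTop) (F := fun M w => ∫ t : ℝ,
      Real.exp (-(e * (X w t + Y t))) *
        ((∑ i ∈ Finset.range (p M), c M i * Real.exp (-(l M i * X w t))) *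
          ∑ j ∈ Finset.range (q M), d M j * Real.exp (-(m M j * Y t)))) (fun M => ?_)
      fun w hw => ?_
    · have hsum : AltDiff 2 n (fun w => ∑ i ∈ Finset.range (p M), ∑ j ∈ Finset.range (q M),
          (c M i * d M j) * ∫ t : ℝ, Real.exp (-((l M i + e) * X w t + (m M j + e) * Y t))) :=
        AltDiff.sum _ fun i _ => AltDiff.sum _ fun j _ =>
          (altDiff_integral_exp_kernel (by linarith [hl M i]) (by linarith [hm M j]) n).const_mul
            (mul_nonneg (hc M i) (hd M j))
      refine hsum.congr fun w hw => ?_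
      have hintg : ∀ i j, Integrable (fun t => (c M i * d M j) *
          Real.exp (-((l M i + e) * X w t + (m M j + e) * Y t))) := fun i j => by
        refine Integrable.const_mul ?_ _
        refine (hdom e he w hw).mono' (by fun_prop) (Eventually.of_forall fun t => ?_)
        rw [Real.norm_of_nonneg (Real.exp_pos _).le]
        gcongr
        nlinarith [hX0 w hw t, hY0 t, hl M i, hm M j,
          mul_nonneg (hl M i) (hX0 w hw t).le, mul_nonneg (hm M j) (hY0 t).le]
      simp only [← integral_const_mul]
      calc _ = ∑ i ∈ Finset.range (p M), ∫ t : ℝ, ∑ j ∈ Finset.range (q M), (c M i * d M j) *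
            Real.exp (-((l M i + e) * X w t + (m M j + e) * Y t)) :=
            Finset.sum_congr rfl fun i _ => (integral_finsetSum _ fun j _ => hintg i j).symm
        _ = ∫ t : ℝ, ∑ i ∈ Finset.range (p M), ∑ j ∈ Finset.range (q M), (c M i * d M j) *
            Real.exp (-((l M i + e) * X w t + (m M j + e) * Y t)) :=
            (integral_finsetSum _ fun i _ => integrable_finsetSum _ fun j _ => hintg i j).symm
        _ = _ := by
            congr 1; ext t
            rw [Finset.sum_mul_sum, Finset.mul_sum]
            refine Finset.sum_congr rfl fun i _ => ?_
            rw [Finset.mul_sum]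
            refine Finset.sum_congr rfl fun j _ => ?_
            have : Real.exp (-((l M i + e) * X w t + (m M j + e) * Y t)) =
                Real.exp (-(e * (X w t + Y t))) * (Real.exp (-(l M i * X w t)) *
                  Real.exp (-(m M j * Y t))) := by
              rw [← Real.exp_add, ← Real.exp_add]; congr 1; ring
            rw [this]; ring
    · refine tendsto_integral_of_dominated_convergence
        (fun t => Real.exp (-(e * (X w t + Y t))) * (C * D)) (fun M => ?_)
        ((hdom e he w hw).mul_const _) (fun M => ?_) ?_
      · fun_prop
      · filter_upwards [hX w hw, hY] with t hXt hYt
        have h1 : 0 ≤ ∑ i ∈ Finset.range (p M), c M i * Real.exp (-(l M i * X w t)) :=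
          Finset.sum_nonneg fun i _ => mul_nonneg (hc M i) (Real.exp_pos _).le
        have h2 : 0 ≤ ∑ j ∈ Finset.range (q M), d M j * Real.exp (-(m M j * Y t)) :=
          Finset.sum_nonneg fun i _ => mul_nonneg (hd M i) (Real.exp_pos _).le
        rw [Real.norm_of_nonneg (by positivity)]
        gcongr
        · exact hcC M _ hXt
        · exact hdD M _ hYt
      · filter_upwards [hX w hw, hY] with t hXt hYt
        exact ((hcf _ hXt).mul (hdg _ hYt)).const_mul _
  refine AltDiff.of_tendsto (l := atTop) (fun j : ℕ => step1 (1 / ((j : ℝ) + 1)) (by positivity))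
    fun w hw => ?_
  refine tendsto_integral_of_dominated_convergence (fun t => ‖f (X w t) * g (Y t)‖)
    (fun j => ?_) (hi w hw).norm (fun j => Eventually.of_forall fun t => ?_)
    (Eventually.of_forall fun t => ?_)
  · exact AEStronglyMeasurable.mul (by fun_prop) (hi w hw).aestronglyMeasurable
  · rw [norm_mul, Real.norm_of_nonneg (Real.exp_pos _).le]
    refine mul_le_of_le_one_left (norm_nonneg _) (Real.exp_le_one_iff.2 ?_)
    have := hX0 w hw t
    have := hY0 t
    have : 0 ≤ 1 / ((j : ℝ) + 1) * (X w t + Y t) := by positivity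
    linarith
  · have h1 : Tendsto (fun j : ℕ => Real.exp (-(1 / ((j : ℝ) + 1) * (X w t + Y t)))) atTop
        (𝓝 (Real.exp (-(0 * (X w t + Y t))))) :=
      (Real.continuous_exp.tendsto _).comp
        ((tendsto_one_div_add_atTop_nhds_zero_nat.mul_const _).neg)
    simpa using h1.mul_const (f (X w t) * g (Y t))

/-- Multiplicative convolution on `(0, ∞)`, in logarithmic coordinates. -/
noncomputable def mulConv (f g : ℝ → ℝ) (x : ℝ) : ℝ :=
  ∫ a : ℝ, f (x * Real.exp (-a)) * g (Real.exp a)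

/-- Products `f (u v) f (u / v)` are bounded completely monotone functions of `v + 1 / v > 2`. -/
def BoundedHCM (f : ℝ → ℝ) : Prop :=
  ∀ u : ℝ, 0 < u → ∃ (φ : ℝ → ℝ) (C : ℝ), CMOn 2 φ ∧ (∀ x, 2 < x → φ x ≤ C) ∧
    ∀ v : ℝ, 0 < v → v ≠ 1 → f (u * v) * f (u / v) = φ (v + 1 / v)

/-- The linear change of variables `(s, t) ↦ (s + t, s - t)`. -/
noncomputable def sumDiffEquiv : (ℝ × ℝ) ≃ₗ[ℝ] (ℝ × ℝ) where
  toFun p := (p.1 + p.2, p.1 - p.2)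
  invFun p := ((p.1 + p.2) / 2, (p.1 - p.2) / 2)
  map_add' p q := by ext <;> simp <;> ring
  map_smul' c p := by ext <;> simp <;> ring
  left_inv p := by ext <;> simp
  right_inv p := by ext <;> simp <;> ring

theorem exists_integral_eq_integral_sumDiff : ∃ c : ℝ, 0 ≤ c ∧ ∀ H : ℝ × ℝ → ℝ,
    Integrable H → Integrable (fun p : ℝ × ℝ => H (p.1 + p.2, p.1 - p.2)) ∧
      ∫ p, H p = c * ∫ p : ℝ × ℝ, H (p.1 + p.2, p.1 - p.2) := by
  let L := sumDiffEquiv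
  have hdet : LinearMap.det (L : (ℝ × ℝ) →ₗ[ℝ] (ℝ × ℝ)) ≠ 0 := (LinearEquiv.isUnit_det' L).ne_zero
  have hmap := Measure.map_linearMap_addHaar_eq_smul_addHaar (volume : Measure (ℝ × ℝ)) hdet
  have hemb : MeasurableEmbedding (L : ℝ × ℝ → ℝ × ℝ) :=
    L.toContinuousLinearEquiv.toHomeomorph.measurableEmbedding
  set k : ℝ := |(LinearMap.det (L : (ℝ × ℝ) →ₗ[ℝ] (ℝ × ℝ)))⁻¹| with hk
  have hk0 : 0 < k := abs_pos.2 (inv_ne_zero hdet)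
  refine ⟨k⁻¹, inv_nonneg.2 hk0.le, fun H hH => ⟨?_, ?_⟩⟩
  · have : Integrable H (Measure.map L volume) := by
      rw [show (Measure.map (L : ℝ × ℝ → ℝ × ℝ) volume) = _ from hmap]
      exact hH.smul_measure ENNReal.ofReal_ne_top
    exact (hemb.integrable_map_iff).1 this
  · have h1 := hemb.integral_map (μ := volume) H
    rw [show (Measure.map (L : ℝ × ℝ → ℝ × ℝ) volume) = _ from hmap, integral_smul_measure,
      ENNReal.toReal_ofReal hk0.le] at h1
    rw [show (∫ p : ℝ × ℝ, H (p.1 + p.2, p.1 - p.2)) = ∫ p, H (L p) from rfl, ← h1, smul_eq_mul]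
    field_simp

/-- Bondesson's theorem: hyperbolic complete monotonicity is preserved by multiplicative
convolution. -/
theorem altDiff_mulConv {f g : ℝ → ℝ} (hf : BoundedHCM f) (hg : BoundedHCM g)
    (hi : ∀ x, 0 < x → Integrable (fun a : ℝ => f (x * Real.exp (-a)) * g (Real.exp a)))
    (hk : ∀ u v s : ℝ, 0 < u → 0 < v → 0 < s → Integrable (fun t : ℝ =>
      f (u * (v * Real.exp (-t))) * f (u / (v * Real.exp (-t))) *
        (g (s * Real.exp t) * g (s / Real.exp t))))
    {u : ℝ} (hu : 0 < u) (n : ℕ) :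
    AltDiff 2 n (fun w => mulConv f g (u * joukowskiInv w) * mulConv f g (u / joukowskiInv w)) := by
  obtain ⟨c, hc, hcov⟩ := exists_integral_eq_integral_sumDiff
  let K : ℝ → ℝ → ℝ → ℝ := fun s w t =>
    f (u / Real.exp s * (joukowskiInv w * Real.exp (-t))) *
      f (u / Real.exp s / (joukowskiInv w * Real.exp (-t))) *
        (g (Real.exp s * Real.exp t) * g (Real.exp s / Real.exp t))
  have hinner : ∀ s, AltDiff 2 n (fun w => ∫ t, K s w t) := fun s => by
    obtain ⟨φ, C, hφ, hφC, hφf⟩ := hf (u / Real.exp s) (by positivity)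
    obtain ⟨ψ, D, hψ, hψD, hψg⟩ := hg (Real.exp s) (Real.exp_pos s)
    have hae : ∀ w, 2 < w → (fun t => K s w t) =ᵐ[volume] fun t =>
        φ (joukowskiInv w * Real.exp (-t) + Real.exp t / joukowskiInv w) *
          ψ (Real.exp t + Real.exp (-t)) := fun w hw => by
      have hv := joukowskiInv_pos hw
      filter_upwards [compl_mem_ae_iff.2 (measure_singleton (Real.log (joukowskiInv w))),
        compl_mem_ae_iff.2 (measure_singleton (0 : ℝ))] with t ht ht0
      simp only [K]
      rw [hφf _ (by positivity) fun h => ?_, hψg _ (Real.exp_pos t) fun h => ht0 (by simpa using h)]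
      · congr 2
        · rw [Real.exp_neg]; field_simp
        · rw [Real.exp_neg, one_div]
      · apply ht
        rw [Real.exp_neg, mul_inv_eq_one₀ (Real.exp_pos t).ne'] at h
        rw [mem_singleton_iff, h, Real.log_exp]
    refine (altDiff_integral_kernel hφ hψ hφC hψD (fun w hw => ?_) n).congr fun w hw =>
      (integral_congr_ae (hae w hw)).symm
    exact (hk _ _ _ (by positivity) (joukowskiInv_pos hw) (Real.exp_pos s)).congr (hae w hw)
  have hprod : ∀ w, 2 < w → Integrable (fun p : ℝ × ℝ => K p.1 w p.2) ∧
      mulConv f g (u * joukowskiInv w) * mulConv f g (u / joukowskiInv w) =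
        c * ∫ p : ℝ × ℝ, K p.1 w p.2 := fun w hw => by
    have hv := joukowskiInv_pos hw
    have h1 := (hi (u * joukowskiInv w) (by positivity)).mul_prod
      (hi (u / joukowskiInv w) (by positivity))
    obtain ⟨h2, h3⟩ := hcov _ h1
    have hKe : ∀ p : ℝ × ℝ, K p.1 w p.2 =
        f (u * joukowskiInv w * Real.exp (-(p.1 + p.2))) * g (Real.exp (p.1 + p.2)) *
          (f (u / joukowskiInv w * Real.exp (-(p.1 - p.2))) * g (Real.exp (p.1 - p.2))) := by
      intro p
      have e1 : u / Real.exp p.1 * (joukowskiInv w * Real.exp (-p.2)) =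
          u * joukowskiInv w * Real.exp (-(p.1 + p.2)) := by
        rw [neg_add, Real.exp_add, Real.exp_neg p.1]; field_simp
      have e2 : u / Real.exp p.1 / (joukowskiInv w * Real.exp (-p.2)) =
          u / joukowskiInv w * Real.exp (-(p.1 - p.2)) := by
        rw [neg_sub, Real.exp_sub, Real.exp_neg]; field_simp
      simp only [K]
      rw [e1, e2, Real.exp_add, Real.exp_sub]
      ring
    simp only [hKe]
    refine ⟨h2, ?_⟩
    rw [mulConv, mulConv, ← integral_prod_mul]
    exact h3
  have houter : AltDiff 2 n (fun w => ∫ s, ∫ t, K s w t) :=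
    AltDiff.integral hinner fun w hw => (hprod w hw).1.integral_prod_left
  refine (houter.const_mul hc).congr fun w hw => ?_
  rw [(hprod w hw).2, Measure.volume_eq_prod, integral_prod _ (hprod w hw).1]

theorem integrable_exp_neg_mul_abs {δ : ℝ} (hδ : 0 < δ) :
    Integrable (fun t : ℝ => Real.exp (-(δ * |t|))) := by
  rw [← integrableOn_univ, ← Iic_union_Ioi (a := (0 : ℝ))]
  refine IntegrableOn.union ?_ ?_
  · refine (integrableOn_exp_mul_Iic hδ 0).congr_fun (fun t ht => ?_) measurableSet_Iic
    simp [abs_of_nonpos (show t ≤ 0 from ht)]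
  · refine (integrableOn_exp_mul_Ioi (neg_lt_zero.2 hδ) 0).congr_fun (fun t ht => ?_)
      measurableSet_Ioi
    simp [abs_of_pos (show 0 < t from ht)]

theorem integrable_exp_mul_div_exp_add {β a : ℝ} (h0 : 0 < β) (h1 : β < 1) (ha : 0 < a) :
    Integrable (fun t : ℝ => Real.exp (β * t) / (Real.exp t + a)) := by
  have hm : 0 < min β (1 - β) := lt_min h0 (by linarith)
  refine ((integrable_exp_neg_mul_abs hm).const_mul (1 + 1 / a)).mono' ?_
    (Eventually.of_forall fun t => ?_)
  · exact (Continuous.div (by fun_prop) (by fun_prop)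
      fun t => (add_pos (Real.exp_pos t) ha).ne').aestronglyMeasurable
  · rw [Real.norm_of_nonneg (by positivity), div_le_iff₀ (by positivity)]
    have h2 : Real.exp (β * t) ≤ Real.exp (-(min β (1 - β) * |t|)) * Real.exp t ∨
        Real.exp (β * t) ≤ Real.exp (-(min β (1 - β) * |t|)) := by
      rcases le_total 0 t with h | h
      · left
        rw [← Real.exp_add, Real.exp_le_exp, abs_of_nonneg h]
        nlinarith [min_le_right β (1 - β)]
      · right
        rw [Real.exp_le_exp, abs_of_nonpos h]
        nlinarith [min_le_left β (1 - β)]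
    set E := Real.exp (-(min β (1 - β) * |t|))
    have hE : 0 < E := Real.exp_pos _
    have ht := Real.exp_pos t
    have : (1 + 1 / a) * E * (Real.exp t + a) = E * Real.exp t + E * a + E * Real.exp t / a + E := by
      field_simp; ring
    rw [this]
    have h3 : 0 < E * Real.exp t := by positivity
    have h4 : 0 < E * a := by positivity
    have h5 : 0 < E * Real.exp t / a := by positivity
    rcases h2 with h2 | h2 <;> linarith

theorem integral_exp_mul_div_exp_add (β : ℝ) {a : ℝ} (ha : 0 < a) :
    ∫ t : ℝ, Real.exp (β * t) / (Real.exp t + a) =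
      a ^ β / a * ∫ t : ℝ, Real.exp (β * t) / (Real.exp t + 1) := by
  rw [← integral_add_right_eq_self (fun t : ℝ => Real.exp (β * t) / (Real.exp t + a)) (Real.log a),
    ← integral_const_mul]
  congr 1
  ext t
  rw [mul_add, Real.exp_add, Real.exp_add, Real.exp_log ha, Real.rpow_def_of_pos ha,
    mul_comm (Real.log a)]
  have := Real.exp_pos t
  field_simp

theorem AltDiff.one_div_add {b A : ℝ} {n : ℕ} (hb : 0 ≤ b) (hA : 0 ≤ A) :
    AltDiff b n (fun w => 1 / (A + w)) := by
  have key : AltDiff b n (fun w => ∫ r in Ioi (0 : ℝ), Real.exp (-(A * |r|)) * Real.exp (-(|r| * w))) := by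
    refine AltDiff.integral (fun t => AltDiff.exp_neg (by positivity) (by positivity))
      fun w hw => ?_
    have hw' : 0 < A + w := by linarith
    refine (integrableOn_exp_mul_Ioi (neg_lt_zero.2 hw') 0).congr_fun (fun t ht => ?_)
      measurableSet_Ioi
    simp only [abs_of_pos (show 0 < t from ht), ← Real.exp_add]
    congr 1; ring
  refine key.congr fun w (hw : b < w) => ?_
  have hw' : 0 < A + w := by linarith
  have h := integral_exp_mul_Ioi (neg_lt_zero.2 hw') 0
  simp only [mul_zero, Real.exp_zero, neg_div_neg_eq] at h
  rw [← h]
  refine setIntegral_congr_fun measurableSet_Ioi fun t ht => ?_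
  simp only [abs_of_pos (show 0 < t from ht), ← Real.exp_add]
  congr 1; ring

theorem joukowskiInv_sub_inv {w : ℝ} (hw : 2 < w) :
    √(w ^ 2 - 4) = joukowskiInv w - 1 / joukowskiInv w := by
  have h := joukowskiInv_add_inv hw
  have h2 : joukowskiInv w * 2 = w + √(w ^ 2 - 4) := by rw [joukowskiInv]; ring
  linarith

theorem contDiffOn_joukowskiInv : ContDiffOn ℝ ∞ joukowskiInv (Ioi 2) := by
  unfold joukowskiInv
  refine ContDiffOn.div_const (contDiffOn_id.add (ContDiffOn.sqrt (by fun_prop) fun w hw => ?_)) 2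
  have : (2 : ℝ) < w := hw
  nlinarith

theorem hasDerivAt_joukowskiInv {w : ℝ} (hw : 2 < w) :
    HasDerivAt joukowskiInv (joukowskiInv w / √(w ^ 2 - 4)) w := by
  have h4 : 0 < w ^ 2 - 4 := by nlinarith
  have hs := Real.sqrt_pos.2 h4
  have h := ((hasDerivAt_id w).add ((((hasDerivAt_id w).pow 2).sub_const 4).sqrt h4.ne')).div_const 2
  refine h.congr_deriv ?_
  simp only [id, joukowskiInv, Pi.pow_apply]
  field_simp
  push_cast
  ring

theorem joukowskiInv_add_one_div {v : ℝ} (hv : 0 < v) (h1 : v ≠ 1) :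
    joukowskiInv (v + 1 / v) = v ∨ joukowskiInv (v + 1 / v) = 1 / v := by
  have hw := two_lt_add_inv hv h1
  have h0 := joukowskiInv_pos hw
  have h := joukowskiInv_add_inv hw
  set V := joukowskiInv (v + 1 / v)
  have : (V - v) * (V - 1 / v) = 0 := by
    field_simp at h ⊢
    linear_combination h
  rcases mul_eq_zero.1 this with h | h
  · left; linarith
  · right; linarith

/-- The map `v + 1 / v ↦ v ^ β + v ^ (-β)`. -/
noncomputable def joukowskiPow (β w : ℝ) : ℝ := joukowskiInv w ^ β + joukowskiInv w ^ (-β)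

theorem joukowskiPow_add_one_div (β : ℝ) {v : ℝ} (hv : 0 < v) (h1 : v ≠ 1) :
    joukowskiPow β (v + 1 / v) = v ^ β + 1 / v ^ β := by
  rw [joukowskiPow]
  rcases joukowskiInv_add_one_div hv h1 with h | h
  · rw [h, Real.rpow_neg hv.le, one_div]
  · rw [h, one_div, one_div, Real.inv_rpow hv.le, Real.inv_rpow hv.le, Real.rpow_neg hv.le,
      inv_inv, add_comm]

theorem two_lt_joukowskiPow {β w : ℝ} (hβ : 0 < β) (hw : 2 < w) : 2 < joukowskiPow β w := by
  have h0 := joukowskiInv_pos hw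
  have h1 := Real.one_lt_rpow (one_lt_joukowskiInv hw) hβ
  rw [joukowskiPow, Real.rpow_neg h0.le, ← one_div]
  exact two_lt_add_inv (by positivity) h1.ne'

theorem contDiffOn_joukowskiPow (β : ℝ) : ContDiffOn ℝ ∞ (joukowskiPow β) (Ioi 2) := by
  unfold joukowskiPow
  exact (contDiffOn_joukowskiInv.rpow_const_of_ne fun w hw => (joukowskiInv_pos hw).ne').add
    (contDiffOn_joukowskiInv.rpow_const_of_ne fun w hw => (joukowskiInv_pos hw).ne')

theorem hasDerivAt_joukowskiPow (β : ℝ) {w : ℝ} (hw : 2 < w) :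
    HasDerivAt (joukowskiPow β)
      (β * ((joukowskiInv w ^ β - joukowskiInv w ^ (-β)) / √(w ^ 2 - 4))) w := by
  have h0 := joukowskiInv_pos hw
  have h := ((hasDerivAt_joukowskiInv hw).rpow_const (p := β) (Or.inl h0.ne')).add
    ((hasDerivAt_joukowskiInv hw).rpow_const (p := -β) (Or.inl h0.ne'))
  refine h.congr_deriv ?_
  rw [Real.rpow_sub_one h0.ne', Real.rpow_sub_one h0.ne']
  field_simp
  ring

theorem cmOn_deriv_joukowskiPow {β : ℝ} (h0 : 0 < β) (h1 : β < 1) :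
    CMOn 2 (fun w => β * ((joukowskiInv w ^ β - joukowskiInv w ^ (-β)) / √(w ^ 2 - 4))) := by
  refine CMOn.of_altDiff ?_ fun n => ?_
  · refine contDiffOn_const.mul (ContDiffOn.div
      ((contDiffOn_joukowskiInv.rpow_const_of_ne fun w hw => (joukowskiInv_pos hw).ne').sub
      (contDiffOn_joukowskiInv.rpow_const_of_ne fun w hw => (joukowskiInv_pos hw).ne'))
      (ContDiffOn.sqrt (by fun_prop) ?_) ?_)
    · intro w (hw : 2 < w); nlinarith
    · intro w (hw : 2 < w); exact (Real.sqrt_pos.2 (by nlinarith)).ne'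
  have hint1 := integrable_exp_mul_div_exp_add h0 h1 one_pos
  set c := ∫ t : ℝ, Real.exp (β * t) / (Real.exp t + 1) with hc
  have hc0 : 0 < c := by
    refine (integral_pos_iff_support_of_nonneg (fun t => by positivity) hint1).2 ?_
    have : Function.support (fun t : ℝ => Real.exp (β * t) / (Real.exp t + 1)) = univ := by
      ext t; simp only [Function.mem_support, mem_univ, iff_true]; positivity
    rw [this]; simp
  have hpf : ∀ w t : ℝ, 2 < w → Real.exp (β * t) * (1 / (Real.exp t + Real.exp (-t) + w)) =
      joukowskiInv w / √(w ^ 2 - 4) * (Real.exp (β * t) / (Real.exp t + joukowskiInv w)) -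
      (1 / joukowskiInv w) / √(w ^ 2 - 4) *
        (Real.exp (β * t) / (Real.exp t + 1 / joukowskiInv w)) := by
    intro w t hw
    have hs : 0 < √(w ^ 2 - 4) := Real.sqrt_pos.2 (by nlinarith)
    have hV := joukowskiInv_pos hw
    have hVw := joukowskiInv_add_inv hw
    rw [joukowskiInv_sub_inv hw] at hs ⊢
    set V := joukowskiInv w
    have ht := Real.exp_pos t
    have hne : V - 1 / V ≠ 0 := hs.ne'
    have hne2 : V ^ 2 - 1 ≠ 0 := by
      intro h; apply hne; field_simp; linarith
    rw [← hVw, Real.exp_neg]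
    set x := Real.exp t
    have e1 : 1 / (x + x⁻¹ + (V + 1 / V)) = x / ((x + V) * (x + 1 / V)) := by
      field_simp
      ring
    rw [e1]
    have p1 : x + V ≠ 0 := by positivity
    have p2 : x + 1 / V ≠ 0 := by positivity
    generalize Real.exp (β * t) = e
    generalize hU : 1 / V = U at *
    field_simp
    ring
  have hw : ∀ w : ℝ, 2 < w →
      Integrable (fun t : ℝ => Real.exp (β * t) * (1 / (Real.exp t + Real.exp (-t) + w))) := by
    intro w hw
    have hV := joukowskiInv_pos hw
    refine (((integrable_exp_mul_div_exp_add h0 h1 hV).const_mul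
      (joukowskiInv w / √(w ^ 2 - 4))).sub
      ((integrable_exp_mul_div_exp_add h0 h1 (one_div_pos.2 hV)).const_mul
      ((1 / joukowskiInv w) / √(w ^ 2 - 4)))).congr (Eventually.of_forall fun t => ?_)
    exact (hpf w t hw).symm
  have key : AltDiff 2 n (fun w => ∫ t : ℝ,
      Real.exp (β * t) * (1 / (Real.exp t + Real.exp (-t) + w))) :=
    AltDiff.integral (fun t => (AltDiff.one_div_add (by norm_num) (by positivity)).const_mul
      (Real.exp_pos _).le) hw
  refine (key.const_mul (c := β / c) (by positivity)).congr fun w (hw2 : 2 < w) => ?_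
  have hV := joukowskiInv_pos hw2
  beta_reduce
  rw [integral_congr_ae (Eventually.of_forall fun t => hpf w t hw2), integral_sub
    ((integrable_exp_mul_div_exp_add h0 h1 hV).const_mul _)
    ((integrable_exp_mul_div_exp_add h0 h1 (one_div_pos.2 hV)).const_mul _),
    integral_const_mul, integral_const_mul, integral_exp_mul_div_exp_add β hV,
    integral_exp_mul_div_exp_add β (one_div_pos.2 hV), ← hc, one_div,
    Real.inv_rpow hV.le, Real.rpow_neg hV.le]
  have := hc0.ne'
  field_simp

theorem HCM.boundedHCM {f : ℝ → ℝ} (hf : HCM f) : BoundedHCM f := by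
  intro u hu
  obtain ⟨φ, hφ, h⟩ := hf u hu
  have hφ' : CMOn 0 φ := hφ
  refine ⟨φ, φ 2, hφ'.mono (by norm_num), fun x hx => ?_, fun v hv _ => h v hv⟩
  exact hφ'.antitoneOn (show (0 : ℝ) < 2 by norm_num) (show (0 : ℝ) < x by linarith) hx.le

/-- If `X` has density `f` then `X ^ (1 / β)` has density `powDensity β f`. -/
noncomputable def powDensity (β : ℝ) (f : ℝ → ℝ) (s : ℝ) : ℝ := β * (f (s ^ β) * s ^ (β - 1))

theorem powDensity_mul_powDensity (β : ℝ) (f : ℝ → ℝ) {u v : ℝ} (hu : 0 < u) (hv : 0 < v) :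
    powDensity β f (u * v) * powDensity β f (u / v) =
      (β * u ^ (β - 1)) ^ 2 * (f (u ^ β * v ^ β) * f (u ^ β / v ^ β)) := by
  rw [powDensity, powDensity, Real.mul_rpow hu.le hv.le, Real.mul_rpow hu.le hv.le,
    Real.div_rpow hu.le hv.le, Real.div_rpow hu.le hv.le]
  have := Real.rpow_pos_of_pos hv (β - 1)
  field_simp

theorem HCM.boundedHCM_powDensity {f : ℝ → ℝ} (hf : HCM f) {β : ℝ} (h0 : 0 < β) (h1 : β < 1) :
    BoundedHCM (powDensity β f) := by
  intro u hu
  obtain ⟨φ, C, hφ, hC, h⟩ := hf.boundedHCM (u ^ β) (by positivity)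
  refine ⟨fun w => (β * u ^ (β - 1)) ^ 2 * φ (joukowskiPow β w), (β * u ^ (β - 1)) ^ 2 * C,
    (hφ.comp (contDiffOn_joukowskiPow β) (fun w hw => two_lt_joukowskiPow h0 hw)
      (fun w hw => hasDerivAt_joukowskiPow β hw) (cmOn_deriv_joukowskiPow h0 h1)).const_mul
      (by positivity), fun x hx => ?_, fun v hv hv1 => ?_⟩
  · exact mul_le_mul_of_nonneg_left (hC _ (two_lt_joukowskiPow h0 hx)) (by positivity)
  · beta_reduce
    rw [powDensity_mul_powDensity β f hu hv, joukowskiPow_add_one_div β hv hv1,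
      h (v ^ β) (by positivity)]
    intro h2
    exact hv1 (by rw [← Real.rpow_rpow_inv hv.le h0.ne', h2, Real.one_rpow])

theorem exp_neg_mul_exp_add_le {c a : ℝ} (hc : 0 < c) (ha : 0 < a) (t : ℝ) :
    Real.exp (-(c * Real.exp (a * t)) + t) ≤ Real.exp (2 / (c * a ^ 2)) * Real.exp (-|t|) := by
  rw [← Real.exp_add, Real.exp_le_exp]
  have h2 : 0 < 2 / (c * a ^ 2) := by positivity
  rcases le_total 0 t with h | h
  · rw [abs_of_nonneg h]
    have h1 := Real.quadratic_le_exp_of_nonneg (mul_nonneg ha.le h)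
    have h3 : c * ((a * t) ^ 2 / 2) ≤ c * Real.exp (a * t) := by
      gcongr
      nlinarith [mul_nonneg ha.le h]
    have h4 : c * ((a * t) ^ 2 / 2) - 2 * t + 2 / (c * a ^ 2) =
        (c * a ^ 2 * t - 2) ^ 2 / (2 * (c * a ^ 2)) := by field_simp; ring
    have h5 : 0 ≤ (c * a ^ 2 * t - 2) ^ 2 / (2 * (c * a ^ 2)) := by positivity
    linarith
  · rw [abs_of_nonpos h]
    have := mul_pos hc (Real.exp_pos (a * t))
    linarith

theorem integrable_exp_neg_mul_exp_add {c a : ℝ} (hc : 0 < c) (ha : 0 < a) :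
    Integrable fun t : ℝ => Real.exp (-(c * Real.exp (a * t)) + t) := by
  refine ((integrable_exp_neg_mul_abs one_pos).const_mul (Real.exp (2 / (c * a ^ 2)))).mono'
    (by fun_prop) (Eventually.of_forall fun t => ?_)
  rw [Real.norm_of_nonneg (Real.exp_pos _).le, one_mul]
  exact exp_neg_mul_exp_add_le hc ha t

theorem exists_exp_mul_le {a e : ℝ} (h0 : 0 < a) (h1 : a < 1) (he : 0 < e) :
    ∃ C : ℝ, ∀ t : ℝ, Real.exp (a * t) ≤ e * Real.exp t + C := by
  refine ⟨Real.exp (a * (Real.log e / (a - 1))), fun t => ?_⟩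
  rcases le_total t (Real.log e / (a - 1)) with h | h
  · have h2 : Real.exp (a * t) ≤ Real.exp (a * (Real.log e / (a - 1))) := by gcongr
    have h3 : 0 < e * Real.exp t := by positivity
    linarith
  · have h1 : Real.exp (a * t) ≤ e * Real.exp t := by
      rw [show e * Real.exp t = Real.exp (Real.log e + t) by rw [Real.exp_add, Real.exp_log he],
        Real.exp_le_exp]
      rw [div_le_iff_of_neg (by linarith)] at h
      linarith
    have := Real.exp_pos (a * (Real.log e / (a - 1)))
    linarith

/-- A holomorphic function decaying exponentially on a horizontal strip has the same integral
along both boundary lines. -/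
theorem integral_strip_eq {F : ℂ → ℂ} {a b R M : ℝ} (hab : a ≤ b)
    (hF : DifferentiableOn ℂ F (im ⁻¹' Icc a b))
    (hM : ∀ ζ : ℂ, ζ.im ∈ Icc a b → R ≤ |ζ.re| → ‖F ζ‖ ≤ M * Real.exp (-|ζ.re|)) :
    (∀ y ∈ Icc a b, Integrable fun t : ℝ => F (t + y * I)) ∧
      ∫ t : ℝ, F (t + a * I) = ∫ t : ℝ, F (t + b * I) := by
  obtain ⟨N, hN⟩ : ∃ N, ∀ ζ : ℂ, ζ.im ∈ Icc a b → ‖F ζ‖ ≤ N * Real.exp (-|ζ.re|) := by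
    have hc : IsCompact (Icc (-R) R ×ℂ Icc a b) := isCompact_Icc.reProdIm isCompact_Icc
    obtain ⟨K, hK⟩ := hc.exists_bound_of_continuousOn (hF.continuousOn.mono fun ζ hζ => hζ.2)
    refine ⟨max M (K * Real.exp R), fun ζ hζ => ?_⟩
    rcases le_total R |ζ.re| with h | h
    · exact (hM ζ hζ h).trans (by gcongr; exact le_max_left _ _)
    · have h1 := hK ζ ⟨abs_le.1 h, hζ⟩
      have hK0 : 0 ≤ K := (norm_nonneg _).trans h1
      calc ‖F ζ‖ ≤ K := h1
        _ = K * Real.exp 0 := by simp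
        _ ≤ K * Real.exp (R + -|ζ.re|) := by gcongr; linarith
        _ = K * Real.exp R * Real.exp (-|ζ.re|) := by rw [Real.exp_add]; ring
        _ ≤ _ := by gcongr; exact le_max_right _ _
  have hintg : ∀ y ∈ Icc a b, Integrable fun t : ℝ => F (t + y * I) := by
    intro y hy
    have hc : Continuous fun t : ℝ => F (t + y * I) :=
      hF.continuousOn.comp_continuous (by fun_prop) fun t => by simpa using hy
    refine ((integrable_exp_neg_mul_abs one_pos).const_mul N).mono' hc.aestronglyMeasurable
      (Eventually.of_forall fun t => ?_)
    simpa using hN (t + y * I) (by simpa using hy)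
  refine ⟨hintg, ?_⟩
  have hvert : ∀ σ : ℝ → ℝ, Tendsto (fun r => |σ r|) atTop atTop →
      Tendsto (fun r : ℝ => I • ∫ y in a..b, F (σ r + y * I)) atTop (𝓝 0) := by
    intro σ hσ
    have hb : ∀ r, ‖I • ∫ y in a..b, F (σ r + y * I)‖ ≤ N * Real.exp (-|σ r|) * |b - a| := by
      intro r
      rw [norm_smul, norm_I, one_mul]
      refine intervalIntegral.norm_integral_le_of_norm_le_const fun y hy => ?_
      rw [uIoc_of_le hab] at hy
      simpa using hN (σ r + y * I) (by simpa using ⟨hy.1.le, hy.2⟩)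
    refine squeeze_zero_norm hb ?_
    have := ((Real.tendsto_exp_neg_atTop_nhds_zero.comp hσ).const_mul N).mul_const |b - a|
    simpa using this
  have h1 := intervalIntegral_tendsto_integral (hintg a ⟨le_rfl, hab⟩)
    tendsto_neg_atTop_atBot (tendsto_id (x := atTop (α := ℝ)))
  have h2 := intervalIntegral_tendsto_integral (hintg b ⟨hab, le_rfl⟩)
    tendsto_neg_atTop_atBot (tendsto_id (x := atTop (α := ℝ)))
  have h3 := hvert id (tendsto_abs_atTop_atTop)
  have h4 := hvert (fun r => -r) (by simpa using tendsto_abs_atTop_atTop)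
  have h5 := ((h1.sub h2).add h3).sub h4
  have h6 : ∀ r : ℝ, ((∫ x in (-r)..id r, F (x + a * I)) - (∫ x in (-r)..id r, F (x + b * I)) +
      (I • ∫ y in a..b, F (id r + y * I)) - I • ∫ y in a..b, F ((-r : ℝ) + y * I)) = 0 := by
    intro r
    have := Complex.integral_boundary_rect_eq_zero_of_differentiableOn F ((-r : ℝ) + a * I)
      (r + b * I) (hF.mono fun ζ hζ => by
        have := hζ.2
        simp [uIcc_of_le hab] at this
        exact this)
    simpa using this
  have h7 := tendsto_nhds_unique (h5.congr h6) tendsto_const_nhds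
  simp only [add_zero, sub_zero] at h7
  exact sub_eq_zero.1 h7

/-- The integrand `exp (x z - z ^ α) dz` of the Laplace inversion formula, in the logarithmic
coordinate `z = exp ζ`. -/
noncomputable def stableKernel (α : ℝ) (z ζ : ℂ) : ℂ :=
  Complex.exp (z * Complex.exp ζ - Complex.exp (α * ζ) + ζ)

/-- The integral of `exp (x z - z ^ α) dz` along the ray of argument `θ`. -/
noncomputable def stableRay (α θ : ℝ) (z : ℂ) : ℂ := ∫ t : ℝ, stableKernel α z (t + θ * I)

theorem norm_stableKernel (α x : ℝ) (ζ : ℂ) :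
    ‖stableKernel α x ζ‖ = Real.exp (x * (Real.exp ζ.re * Real.cos ζ.im) -
      Real.exp (α * ζ.re) * Real.cos (α * ζ.im) + ζ.re) := by
  rw [stableKernel, Complex.norm_exp]
  simp [Complex.exp_re]

theorem differentiable_stableKernel (α : ℝ) (z : ℂ) : Differentiable ℂ (stableKernel α z) := by
  unfold stableKernel
  fun_prop

theorem exists_norm_stableKernel_le {α θ x : ℝ} (h0 : 0 < α) (h1 : α < 1) (hθ : Real.pi / 2 < θ)
    (hx : 0 < x) : ∃ M, ∀ ζ : ℂ, |ζ.im| ∈ Icc θ Real.pi →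
      ‖stableKernel α x ζ‖ ≤ M * Real.exp (-|ζ.re|) := by
  rcases le_or_gt θ Real.pi with hπ | hπ
  swap
  · exact ⟨0, fun ζ hζ => absurd (hζ.1.trans hζ.2) (not_le.2 hπ)⟩
  have hκ : 0 < -Real.cos θ := by
    have := Real.cos_neg_of_pi_div_two_lt_of_lt hθ (by linarith [Real.pi_pos])
    linarith
  obtain ⟨C, hC⟩ := exists_exp_mul_le h0 h1 (e := x * -Real.cos θ / 2) (by positivity)
  refine ⟨Real.exp C * Real.exp (2 / (x * -Real.cos θ / 2 * 1 ^ 2)), fun ζ hζ => ?_⟩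
  have hb := exp_neg_mul_exp_add_le (c := x * -Real.cos θ / 2) (by positivity) one_pos ζ.re
  rw [norm_stableKernel]
  have hcos : Real.cos ζ.im ≤ Real.cos θ := by
    rw [← Real.cos_abs ζ.im]
    exact Real.cos_le_cos_of_nonneg_of_le_pi (by linarith [Real.pi_pos]) hζ.2 hζ.1
  calc _ ≤ Real.exp (C + (-(x * -Real.cos θ / 2 * Real.exp (1 * ζ.re)) + ζ.re)) := by
        rw [Real.exp_le_exp]
        have e1 := hC ζ.re
        have e2 : Real.exp ζ.re * Real.cos ζ.im ≤ Real.exp ζ.re * Real.cos θ := by gcongr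
        have e3 := mul_le_mul_of_nonneg_left e2 hx.le
        have e4 := mul_le_mul_of_nonneg_left (Real.neg_one_le_cos (α * ζ.im))
          (Real.exp_pos (α * ζ.re)).le
        rw [one_mul]
        nlinarith
    _ ≤ _ := by
        rw [Real.exp_add, mul_assoc]
        gcongr

theorem integrable_stableKernel {α θ x : ℝ} (h0 : 0 < α) (h1 : α < 1) (hθ : Real.pi / 2 < θ)
    (hπ : θ ≤ Real.pi) (hx : 0 < x) {y : ℝ} (hy : |y| = θ) :
    Integrable fun t : ℝ => stableKernel α x (t + y * I) := by
  obtain ⟨M, hM⟩ := exists_norm_stableKernel_le h0 h1 hθ hx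
  refine ((integrable_exp_neg_mul_abs one_pos).const_mul M).mono'
    ((differentiable_stableKernel α x).continuous.comp (by fun_prop)).aestronglyMeasurable
    (Eventually.of_forall fun t => ?_)
  simpa using hM (t + y * I) (by simpa [hy] using hπ)

theorem stableRay_eq {α θ x : ℝ} (h0 : 0 < α) (h1 : α < 1) (hθ : Real.pi / 2 < θ)
    (hπ : θ ≤ Real.pi) (hx : 0 < x) : stableRay α θ x = stableRay α Real.pi x := by
  obtain ⟨M, hM⟩ := exists_norm_stableKernel_le h0 h1 hθ hx
  refine (integral_strip_eq (R := 0) hπ (differentiable_stableKernel α x).differentiableOn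
    fun ζ hζ _ => hM ζ ?_).2
  rwa [abs_of_pos (by linarith [hζ.1, Real.pi_pos])]

theorem stableRay_neg (α θ x : ℝ) :
    stableRay α (-θ) x = (starRingEnd ℂ) (stableRay α θ x) := by
  rw [stableRay, stableRay, ← integral_conj]
  congr 1
  ext t
  simp only [stableKernel, ← Complex.exp_conj]
  simp [← Complex.exp_conj]

theorem integral_Ioi_eq_integral_exp {E : Type*} [NormedAddCommGroup E] [NormedSpace ℝ E]
    {x : ℝ} (hx : 0 < x) (F : ℝ → E) :
    ∫ y in Ioi (0 : ℝ), F y = ∫ t : ℝ, (x * Real.exp t) • F (x * Real.exp t) := by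
  have hinj : InjOn (fun t : ℝ => x * Real.exp t) univ := fun a _ b _ h =>
    Real.exp_injective (mul_left_cancel₀ hx.ne' h)
  have himg : (fun t : ℝ => x * Real.exp t) '' univ = Ioi 0 := by
    ext y
    simp only [image_univ, mem_range, mem_Ioi]
    constructor
    · rintro ⟨t, rfl⟩; positivity
    · intro hy
      exact ⟨Real.log (y / x), by rw [Real.exp_log (by positivity)]; field_simp⟩
  rw [← himg, integral_image_eq_integral_abs_deriv_smul MeasurableSet.univ
    (fun t _ => ((Real.hasDerivAt_exp t).const_mul x).hasDerivWithinAt) hinj, setIntegral_univ]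
  congr 1
  ext t
  rw [abs_of_pos (by positivity)]

theorem ofReal_mul_exp_cpow_mul_cpow_neg {x : ℝ} (hx : 0 < x) (a t : ℝ) :
    ((x * Real.exp t : ℝ) : ℂ) ^ (a : ℂ) * (x : ℂ) ^ (-(a : ℂ)) = Complex.exp (a * t) := by
  rw [← ofReal_neg, ← ofReal_cpow (by positivity), ← ofReal_cpow hx.le, ← ofReal_mul,
    Real.mul_rpow hx.le (Real.exp_pos t).le, Real.rpow_neg hx.le, ← Real.exp_mul]
  have := (Real.rpow_pos_of_pos hx a).ne'
  rw [show x ^ a * Real.exp (t * a) * (x ^ a)⁻¹ = Real.exp (a * t) by field_simp]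
  push_cast
  rfl

/-- Zolotarev's formula with the ray of argument `π` turned to the argument `θ`. -/
theorem stableDensity_eq_rayDiff {α θ x : ℝ} (h0 : 0 < α) (h1 : α < 1) (hθ : Real.pi / 2 < θ)
    (hπ : θ ≤ Real.pi) (hx : 0 < x) :
    (stableDensity α 1 x : ℂ) =
      (2 * Real.pi * I)⁻¹ * (stableRay α θ x - stableRay α (-θ) x) := by
  have hreal : ∀ J : ℂ, ((((2 * Real.pi * I)⁻¹ * (J - (starRingEnd ℂ) J)).re : ℝ) : ℂ) =
      (2 * Real.pi * I)⁻¹ * (J - (starRingEnd ℂ) J) := by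
    intro J
    have hJ : (2 * Real.pi * I)⁻¹ * (J - (starRingEnd ℂ) J) = ((J.im / Real.pi : ℝ) : ℂ) := by
      rw [Complex.sub_conj]
      have := Real.pi_ne_zero
      push_cast
      field_simp
    rw [hJ, ofReal_re]
  rw [stableRay_neg, stableRay_eq h0 h1 hθ hπ hx, ← hreal, ← stableRay_neg, stableDensity]
  congr 3
  rw [stableRay, stableRay, ← integral_sub
    (integrable_stableKernel h0 h1 (by linarith [Real.pi_pos]) le_rfl hx (abs_of_pos Real.pi_pos))
    (integrable_stableKernel h0 h1 (by linarith [Real.pi_pos]) le_rfl hx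
      (by rw [abs_neg, abs_of_pos Real.pi_pos]))]
  rw [integral_Ioi_eq_integral_exp hx]
  congr 1
  ext t
  simp only [mul_assoc, ofReal_mul_exp_cpow_mul_cpow_neg hx]
  have hx0 : (x : ℂ) ≠ 0 := ofReal_ne_zero.2 hx.ne'
  have e1 : Complex.exp (t + Real.pi * I) = -Complex.exp t := by
    rw [Complex.exp_add, Complex.exp_pi_mul_I]; ring
  have e2 : Complex.exp (t + ((-Real.pi : ℝ) : ℂ) * I) = -Complex.exp t := by
    rw [Complex.exp_add, ofReal_neg, neg_mul, Complex.exp_neg, Complex.exp_pi_mul_I]; norm_num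
  have key : ∀ y : ℝ, Complex.exp (t + y * I) = -Complex.exp t →
      stableKernel α x (t + y * I) = -Complex.exp t *
        (Complex.exp (-(Complex.exp (y * α * I) * Complex.exp (α * t))) *
          Complex.exp (-(x * Complex.exp t))) := by
    intro y hy
    rw [stableKernel, Complex.exp_add, hy, mul_comm, ← Complex.exp_add, ← Complex.exp_add]
    congr 2
    rw [show (α : ℂ) * (t + y * I) = y * α * I + α * t by ring]
    ring
  rw [key _ e1, key _ e2, real_smul]
  push_cast
  simp only [one_mul, mul_assoc, neg_mul]
  field_simp
  ring

theorem norm_stableKernel_of_abs_im_eq_pi {α y : ℝ} (hy : |y| = Real.pi) (z : ℂ) (t : ℝ) :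
    ‖stableKernel α z (t + y * I)‖ =
      Real.exp (-(z.re * Real.exp t)) * Real.exp (-(Real.exp (α * t) * Real.cos (α * y)) + t) := by
  have hs : Real.sin y = 0 := by
    rcases abs_choice y with h | h <;> rw [h] at hy
    · rw [hy]; simp
    · rw [show y = -Real.pi by linarith]; simp
  have hc : Real.cos y = -1 := by rw [← Real.cos_abs, hy, Real.cos_pi]
  rw [stableKernel, Complex.norm_exp, ← Real.exp_add]
  congr 1
  simp [Complex.exp_re, Complex.exp_im, hs, hc]
  ring

theorem differentiableOn_stableRay {α y : ℝ} (h0 : 0 < α) (h1 : α < 1) (hy : |y| = Real.pi) :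
    DifferentiableOn ℂ (stableRay α y) {z | 0 < z.re} := by
  intro z₀ (hz₀ : 0 < z₀.re)
  refine DifferentiableAt.differentiableWithinAt ?_
  have hx : 0 < z₀.re / 2 := by positivity
  have hx2 : 0 < z₀.re / 2 / 2 := by positivity
  have hpi := Real.pi_pos
  have hopen : {z : ℂ | z₀.re / 2 < z.re} ∈ 𝓝 z₀ :=
    (isOpen_lt continuous_const Complex.continuous_re).mem_nhds (by simpa using hz₀)
  have hcont : ∀ z : ℂ, Continuous fun t : ℝ => stableKernel α z (t + y * I) := fun z =>
    (differentiable_stableKernel α z).continuous.comp (by fun_prop)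
  have hintg : Integrable fun t : ℝ => stableKernel α z₀ (t + y * I) := by
    refine (integrable_stableKernel h0 h1 (x := z₀.re) (by linarith) le_rfl hz₀ hy).mono
      (hcont z₀).aestronglyMeasurable (Eventually.of_forall fun t => ?_)
    rw [norm_stableKernel_of_abs_im_eq_pi hy, norm_stableKernel_of_abs_im_eq_pi hy, ofReal_re]
  refine (hasDerivAt_integral_of_dominated_loc_of_deriv_le
    (F := fun z (t : ℝ) => stableKernel α z (t + y * I))
    (F' := fun z (t : ℝ) => Complex.exp (t + y * I) * stableKernel α z (t + y * I))
    (bound := fun t : ℝ => (z₀.re / 2 / 2)⁻¹ * ‖stableKernel α (z₀.re / 2 / 2 : ℝ) (t + y * I)‖)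
    hopen (Eventually.of_forall fun z => (hcont z).aestronglyMeasurable) hintg
    ?_ ?_ ?_ ?_).2.differentiableAt
  · exact ((by fun_prop : Continuous fun t : ℝ => Complex.exp (t + y * I)).mul
      (hcont z₀)).aestronglyMeasurable
  · refine Eventually.of_forall fun t z (hz : z₀.re / 2 < z.re) => ?_
    rw [norm_mul, norm_stableKernel_of_abs_im_eq_pi hy, norm_stableKernel_of_abs_im_eq_pi hy,
      Complex.norm_exp, ofReal_re, ← mul_assoc, ← mul_assoc]
    refine mul_le_mul_of_nonneg_right ?_ (Real.exp_pos _).le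
    have e1 : ((t : ℂ) + y * I).re = t := by simp
    rw [e1, le_inv_mul_iff₀ hx2]
    have h2 := Real.add_one_le_exp (z₀.re / 2 / 2 * Real.exp t)
    calc _ ≤ Real.exp (z₀.re / 2 / 2 * Real.exp t) * Real.exp (-(z₀.re / 2 * Real.exp t)) := by
          rw [← mul_assoc]
          gcongr
          linarith
      _ = _ := by rw [← Real.exp_add]; congr 1; ring
  · exact ((integrable_stableKernel h0 h1 (by linarith) le_rfl hx2 hy).norm).const_mul _
  · refine Eventually.of_forall fun t z _ => ?_
    have := ((((hasDerivAt_id z).mul_const (Complex.exp (t + y * I))).sub_const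
      (Complex.exp (α * (t + y * I)))).add_const (t + y * I : ℂ)).cexp
    refine this.congr_deriv ?_
    simp only [stableKernel, id]
    ring

/-- The holomorphic extension of the stable density to the right half-plane. -/
noncomputable def stableExt (α : ℝ) (z : ℂ) : ℂ :=
  (2 * Real.pi * I)⁻¹ * (stableRay α Real.pi z - stableRay α (-Real.pi) z)

theorem differentiableOn_stableExt {α : ℝ} (h0 : 0 < α) (h1 : α < 1) :
    DifferentiableOn ℂ (stableExt α) {z | 0 < z.re} :=
  ((differentiableOn_stableRay h0 h1 (abs_of_pos Real.pi_pos)).sub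
    (differentiableOn_stableRay h0 h1 (by rw [abs_neg, abs_of_pos Real.pi_pos]))).const_mul _

theorem stableExt_ofReal {α x : ℝ} (h0 : 0 < α) (h1 : α < 1) (hx : 0 < x) :
    stableExt α x = stableDensity α 1 x :=
  (stableDensity_eq_rayDiff h0 h1 (by linarith [Real.pi_pos]) le_rfl hx).symm

theorem continuousOn_stableDensity {α : ℝ} (h0 : 0 < α) (h1 : α < 1) :
    ContinuousOn (stableDensity α 1) (Ioi 0) := by
  have h : ContinuousOn (fun x : ℝ => (stableExt α x).re) (Ioi 0) :=
    Complex.continuous_re.comp_continuousOn ((differentiableOn_stableExt h0 h1).continuousOn.comp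
      Complex.continuous_ofReal.continuousOn fun x hx => by simpa using hx)
  refine h.congr fun x hx => ?_
  beta_reduce
  rw [stableExt_ofReal h0 h1 hx, ofReal_re]

theorem exists_angle {α : ℝ} (h0 : 0 < α) (h1 : α < 1) :
    ∃ θ : ℝ, Real.pi / 2 < θ ∧ θ < Real.pi ∧ α * θ < Real.pi / 2 := by
  have hpi := Real.pi_pos
  have : Real.pi / 2 < min Real.pi (Real.pi / (2 * α)) := by
    refine lt_min (by linarith) ?_
    rw [div_lt_div_iff₀ (by norm_num) (by positivity)]
    nlinarith
  obtain ⟨θ, ha, hb⟩ := exists_between this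
  refine ⟨θ, ha, hb.trans_le (min_le_left _ _), ?_⟩
  have := hb.trans_le (min_le_right _ _)
  rw [lt_div_iff₀ (by positivity)] at this
  linarith

theorem cos_pos_of_angle {α θ : ℝ} (h0 : 0 < α) (hθ : Real.pi / 2 < θ)
    (hαθ : α * θ < Real.pi / 2) : 0 < Real.cos (α * θ) := by
  have : 0 < θ := by linarith [Real.pi_pos]
  exact Real.cos_pos_of_mem_Ioo ⟨by linarith [Real.pi_pos, mul_pos h0 this], hαθ⟩

theorem cos_neg_of_angle {θ : ℝ} (hθ : Real.pi / 2 < θ) (hπ : θ < Real.pi) :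
    0 < -Real.cos θ := by
  have := Real.cos_neg_of_pi_div_two_lt_of_lt hθ (by linarith [Real.pi_pos])
  linarith

theorem exists_abs_stableDensity_le {α : ℝ} (h0 : 0 < α) (h1 : α < 1) :
    ∃ C : ℝ, 0 ≤ C ∧ ∀ x, 0 < x → |stableDensity α 1 x| ≤ C ∧ |stableDensity α 1 x| ≤ C / x := by
  obtain ⟨θ, hθ, hπ, hαθ⟩ := exists_angle h0 h1
  have hc := cos_pos_of_angle h0 hθ hαθ
  have hκ := cos_neg_of_angle hθ hπ
  set c := Real.cos (α * θ) with hcdef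
  set κ := -Real.cos θ with hκdef
  have hint1 := integrable_exp_neg_mul_exp_add hc h0
  have hle : ∀ x, 0 < x → |stableDensity α 1 x| ≤ ‖stableRay α θ x‖ := by
    intro x hx
    have hg := stableDensity_eq_rayDiff h0 h1 hθ hπ.le hx
    rw [stableRay_neg] at hg
    rw [← Real.norm_eq_abs, ← Complex.norm_real, hg, norm_mul]
    have e1 : ‖(2 * (Real.pi : ℂ) * I)⁻¹‖ = (2 * Real.pi)⁻¹ := by
      simp [abs_of_pos Real.pi_pos]
    have e2 := norm_sub_le (stableRay α θ x) ((starRingEnd ℂ) (stableRay α θ x))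
    rw [RCLike.norm_conj] at e2
    rw [e1, inv_mul_le_iff₀ (by positivity)]
    nlinarith [Real.pi_gt_three, norm_nonneg (stableRay α θ x)]
  have hn : ∀ x t : ℝ, ‖stableKernel α x (t + θ * I)‖ =
      Real.exp (-(κ * (x * Real.exp t)) + (-(c * Real.exp (α * t)) + t)) := by
    intro x t
    rw [norm_stableKernel]
    simp only [add_re, ofReal_re, mul_re, I_re, mul_zero, ofReal_im, I_im, mul_one, sub_self,
      add_zero, add_im, mul_im, zero_add, ← hcdef]
    congr 1
    rw [hκdef]; ring
  set A := ∫ t : ℝ, Real.exp (-(c * Real.exp (α * t)) + t)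
  refine ⟨max A (1 / κ), le_max_of_le_right (by positivity), fun x hx => ⟨?_, ?_⟩⟩
  · refine (hle x hx).trans (le_max_of_le_left ?_)
    refine norm_integral_le_of_norm_le hint1 (Eventually.of_forall fun t => ?_)
    rw [hn, Real.exp_le_exp]
    have : 0 < κ * (x * Real.exp t) := by positivity
    linarith
  · refine (hle x hx).trans ((?_ : _ ≤ (1 / κ) / x).trans (by gcongr; exact le_max_right _ _))
    have hint2 : Integrable fun t : ℝ => x⁻¹ * ((x * Real.exp t) • Real.exp (-(κ * (x * Real.exp t)))) := by
      refine (integrable_exp_neg_mul_exp_add (mul_pos hκ hx) one_pos).congr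
        (Eventually.of_forall fun t => ?_)
      simp only [smul_eq_mul, Real.exp_add, one_mul, mul_assoc]
      field_simp
    have hval := integral_exp_mul_Ioi (neg_lt_zero.2 hκ) 0
    simp only [mul_zero, Real.exp_zero, neg_div_neg_eq] at hval
    rw [integral_Ioi_eq_integral_exp hx] at hval
    rw [← hval, div_eq_inv_mul, ← integral_const_mul]
    simp only [neg_mul]
    refine norm_integral_le_of_norm_le hint2 (Eventually.of_forall fun t => ?_)
    rw [hn, smul_eq_mul]
    calc _ ≤ Real.exp (-(κ * (x * Real.exp t)) + t) := by
          gcongr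
          have : 0 < c * Real.exp (α * t) := by positivity
          linarith
      _ = _ := by rw [Real.exp_add]; field_simp

theorem re_exp_add_mul_I (t y : ℝ) : (Complex.exp (t + y * I)).re = Real.exp t * Real.cos y := by
  simp [Complex.exp_re]

theorem im_exp_add_mul_I (t y : ℝ) : (Complex.exp (t + y * I)).im = Real.exp t * Real.sin y := by
  simp [Complex.exp_im]

theorem laplace_stableRay {α θ y : ℝ} (h0 : 0 < α) (hθ : Real.pi / 2 < θ) (hπ : θ < Real.pi)
    (hαθ : α * θ < Real.pi / 2) (hy : |y| = θ) {s : ℂ} (hs : 0 < s.re) :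
    IntegrableOn (fun x : ℝ => Complex.exp (-(s * x)) * stableRay α y x) (Ioi 0) ∧
    Integrable (fun t : ℝ => Complex.exp (t + y * I) * Complex.exp (-Complex.exp (α * (t + y * I))) /
      (s - Complex.exp (t + y * I))) ∧
    ∫ x in Ioi (0 : ℝ), Complex.exp (-(s * x)) * stableRay α y x =
      ∫ t : ℝ, Complex.exp (t + y * I) * Complex.exp (-Complex.exp (α * (t + y * I))) /
        (s - Complex.exp (t + y * I)) := by
  have hc := cos_pos_of_angle h0 hθ hαθ
  have hκ := cos_neg_of_angle hθ hπ
  have hcy : Real.cos (α * y) = Real.cos (α * θ) := by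
    rw [← Real.cos_abs (α * y), abs_mul, abs_of_pos h0, hy]
  have hcy2 : Real.cos y = Real.cos θ := by rw [← Real.cos_abs y, hy]
  have hprod : Integrable (fun p : ℝ × ℝ => Complex.exp (-(s * p.1)) *
      stableKernel α p.1 (p.2 + y * I)) ((volume.restrict (Ioi 0)).prod volume) := by
    have hi1 : Integrable (fun x : ℝ => Real.exp (-s.re * x)) (volume.restrict (Ioi 0)) :=
      integrableOn_exp_mul_Ioi (neg_lt_zero.2 hs) 0
    refine (hi1.mul_prod (integrable_exp_neg_mul_exp_add hc h0)).mono' ?_ ?_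
    · unfold stableKernel
      exact (by fun_prop : Continuous fun p : ℝ × ℝ => Complex.exp (-(s * p.1)) *
        Complex.exp (p.1 * Complex.exp (p.2 + y * I) - Complex.exp (α * (p.2 + y * I)) +
          (p.2 + y * I))).aestronglyMeasurable
    · have hpos : ∀ᵐ p : ℝ × ℝ ∂((volume.restrict (Ioi 0)).prod volume), 0 < p.1 :=
        Measure.quasiMeasurePreserving_fst.ae (ae_restrict_mem measurableSet_Ioi)
      filter_upwards [hpos] with p hp
      rw [norm_mul, norm_stableKernel, Complex.norm_exp]
      simp only [neg_re, mul_re, ofReal_re, ofReal_im, mul_zero, sub_zero, add_re, I_re, I_im,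
        mul_one, sub_self, add_zero, add_im, mul_im, zero_add, neg_mul]
      rw [hcy, hcy2]
      gcongr
      have : 0 < p.1 * (Real.exp p.2 * -Real.cos θ) := by positivity
      linarith
  have hinner : ∀ t : ℝ, ∫ x in Ioi (0 : ℝ), Complex.exp (-(s * x)) *
      stableKernel α x (t + y * I) = Complex.exp (t + y * I) *
        Complex.exp (-Complex.exp (α * (t + y * I))) / (s - Complex.exp (t + y * I)) := by
    intro t
    have hre : (Complex.exp (t + y * I) - s).re < 0 := by
      rw [sub_re, re_exp_add_mul_I, hcy2]
      nlinarith [Real.exp_pos t]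
    have h := integral_exp_mul_complex_Ioi hre 0
    simp only [ofReal_zero, mul_zero, Complex.exp_zero] at h
    rw [div_eq_mul_inv, show (s - Complex.exp (t + y * I))⁻¹ =
      -1 / (Complex.exp (t + y * I) - s) by rw [neg_div, one_div, ← neg_inv.symm, neg_sub], ← h,
      ← integral_const_mul]
    congr 1
    ext x
    rw [stableKernel, ← Complex.exp_add, ← Complex.exp_add, ← Complex.exp_add]
    congr 1
    ring
  refine ⟨?_, ?_, ?_⟩
  · refine hprod.integral_prod_left.congr (Eventually.of_forall fun x => ?_)
    simp only [integral_const_mul, stableRay]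
  · refine hprod.integral_prod_right.congr (Eventually.of_forall fun t => ?_)
    exact hinner t
  · have := integral_integral_swap (f := fun x t : ℝ => Complex.exp (-(s * x)) *
      stableKernel α x (t + y * I)) hprod
    simp only [integral_const_mul, hinner] at this
    exact this

theorem integral_exp_line_eq {s : ℂ} (hs : 0 < s.re) {y η : ℝ} (hcos : Real.cos y < 0)
    (hy : |y| < Real.pi) (hsin : Real.sin y ≠ 0) (hη : Complex.exp (η * I) = -1)
    (hyη : |y - η| < Real.pi)
    (hintg : Integrable fun t : ℝ => Complex.exp (t + y * I) * (1 + s) /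
      ((s - Complex.exp (t + y * I)) * (1 + Complex.exp (t + y * I)))) :
    ∫ t : ℝ, Complex.exp (t + y * I) * (1 + s) /
      ((s - Complex.exp (t + y * I)) * (1 + Complex.exp (t + y * I))) = η * I + Complex.log s := by
  have hs0 : s ≠ 0 := fun h => by simp [h] at hs
  have hA : ∀ t : ℝ, 1 + Complex.exp (t + y * I) ∈ slitPlane := fun t => by
    refine mem_slitPlane_iff.2 (Or.inr ?_)
    rw [add_im, im_exp_add_mul_I, one_im, zero_add]
    exact mul_ne_zero (Real.exp_pos t).ne' hsin
  have hB : ∀ t : ℝ, s - Complex.exp (t + y * I) ∈ slitPlane := fun t => by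
    refine mem_slitPlane_iff.2 (Or.inl ?_)
    rw [sub_re, re_exp_add_mul_I]
    nlinarith [Real.exp_pos t]
  have hexp : Complex.exp (y * I) ∈ slitPlane := mem_slitPlane_iff.2 (Or.inr (by simpa using hsin))
  have hexp' : -Complex.exp (y * I) ∈ slitPlane :=
    mem_slitPlane_iff.2 (Or.inl (by simpa [Complex.exp_re] using hcos))
  have hderiv : ∀ t : ℝ, HasDerivAt (fun t : ℝ => Complex.log (1 + Complex.exp (t + y * I)) -
      Complex.log (s - Complex.exp (t + y * I)))
      (Complex.exp (t + y * I) * (1 + s) /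
        ((s - Complex.exp (t + y * I)) * (1 + Complex.exp (t + y * I)))) t := by
    intro t
    have h1 : HasDerivAt (fun t : ℝ => Complex.exp (t + y * I)) (Complex.exp (t + y * I)) t := by
      have := ((hasDerivAt_id t).ofReal_comp.add_const ((y : ℂ) * I)).cexp
      simpa using this
    refine (((h1.const_add 1).clog_real (hA t)).sub
      ((h1.const_sub s).clog_real (hB t))).congr_deriv ?_
    have := slitPlane_ne_zero (hA t)
    have := slitPlane_ne_zero (hB t)
    field_simp
    ring
  have hbot : Tendsto (fun t : ℝ => Complex.log (1 + Complex.exp (t + y * I)) -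
      Complex.log (s - Complex.exp (t + y * I))) atBot (𝓝 (Complex.log (1 + 0) - Complex.log (s - 0))) := by
    have h0 : Tendsto (fun t : ℝ => Complex.exp (t + y * I)) atBot (𝓝 0) := by
      rw [tendsto_zero_iff_norm_tendsto_zero]
      simpa [Complex.norm_exp] using Real.tendsto_exp_atBot
    exact ((tendsto_const_nhds.add h0).clog (by simp)).sub ((tendsto_const_nhds.sub h0).clog
      (by rw [sub_zero]; exact mem_slitPlane_iff.2 (Or.inl hs)))
  have htop : Tendsto (fun t : ℝ => Complex.log (1 + Complex.exp (t + y * I)) -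
      Complex.log (s - Complex.exp (t + y * I))) atTop
      (𝓝 (Complex.log (0 + Complex.exp (y * I)) - Complex.log (s * 0 - Complex.exp (y * I)))) := by
    have h0 : Tendsto (fun t : ℝ => ((Real.exp (-t) : ℝ) : ℂ)) atTop (𝓝 0) := by
      rw [← ofReal_zero]
      exact (Complex.continuous_ofReal.tendsto 0).comp Real.tendsto_exp_neg_atTop_nhds_zero
    have h := ((h0.add (tendsto_const_nhds (x := Complex.exp (y * I)))).clog
      (by rwa [zero_add])).sub (((h0.const_mul s).sub
        (tendsto_const_nhds (x := Complex.exp (y * I)))).clog (by simpa using hexp'))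
    refine h.congr fun t => ?_
    have e0 : Complex.exp (t + y * I) = Real.exp t * Complex.exp (y * I) := by
      rw [Complex.exp_add]; push_cast; rfl
    have e2 : (Real.exp t : ℂ) * Real.exp (-t) = 1 := by
      rw [← ofReal_mul, ← Real.exp_add]; simp
    have e1 : 1 + Complex.exp (t + y * I) =
        Real.exp t * (Real.exp (-t) + Complex.exp (y * I)) := by
      rw [mul_add, e2, e0]
    have e3 : s - Complex.exp (t + y * I) =
        Real.exp t * (s * Real.exp (-t) - Complex.exp (y * I)) := by
      rw [mul_sub, mul_left_comm, e2, e0, mul_one]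
    have n1 := slitPlane_ne_zero (hA t)
    have n2 := slitPlane_ne_zero (hB t)
    rw [e1] at n1 ⊢
    rw [e3] at n2 ⊢
    rw [Complex.log_ofReal_mul (Real.exp_pos t) (right_ne_zero_of_mul n1),
      Complex.log_ofReal_mul (Real.exp_pos t) (right_ne_zero_of_mul n2)]
    ring
  rw [integral_of_hasDerivAt_of_tendsto hderiv hintg hbot htop]
  have l1 : Complex.log (0 + Complex.exp (y * I)) = y * I := by
    rw [zero_add, Complex.log_exp] <;> simp <;> linarith [(abs_lt.1 hy).1, (abs_lt.1 hy).2]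
  have l2 : Complex.log (s * 0 - Complex.exp (y * I)) = (y - η : ℝ) * I := by
    have : s * 0 - Complex.exp (y * I) = Complex.exp ((y - η : ℝ) * I) := by
      have hη0 : Complex.exp (-(η * I)) = -1 := by rw [Complex.exp_neg, hη]; norm_num
      push_cast
      rw [sub_mul, sub_eq_add_neg ((y : ℂ) * I), Complex.exp_add, hη0]
      ring
    rw [this, Complex.log_exp] <;> simp <;> linarith [(abs_lt.1 hyη).1, (abs_lt.1 hyη).2]
  rw [l1, l2, add_zero, Complex.log_one, sub_zero]
  push_cast
  ring

/-- The regular part of `exp ζ * E ζ / (s - exp ζ)`, where `s = exp σ`, after subtraction of a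
multiple of `exp ζ / ((s - exp ζ) * (1 + exp ζ))`. -/
noncomputable def expRegularPart (E : ℂ → ℂ) (σ ζ : ℂ) : ℂ :=
  -(Complex.exp ζ * dslope (fun w => E w * (1 + Complex.exp w)) σ ζ /
    (dslope Complex.exp σ ζ * (1 + Complex.exp ζ)))

theorem one_add_exp_ne_zero {ζ : ℂ} (h : |ζ.im| < Real.pi) : 1 + Complex.exp ζ ≠ 0 := by
  intro h0
  have h1 := Complex.log_exp (abs_lt.1 h).1 (abs_lt.1 h).2.le
  rw [show Complex.exp ζ = -1 by linear_combination h0, Complex.log_neg_one] at h1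
  rw [← h1] at h
  simp [abs_of_pos Real.pi_pos] at h

theorem exp_eq_exp_of_abs_im_lt {ζ σ : ℂ} (h : |ζ.im| < Real.pi) (h' : |σ.im| < Real.pi)
    (he : Complex.exp ζ = Complex.exp σ) : ζ = σ := by
  rw [← Complex.log_exp (abs_lt.1 h).1 (abs_lt.1 h).2.le, he,
    Complex.log_exp (abs_lt.1 h').1 (abs_lt.1 h').2.le]

theorem dslope_exp_ne_zero {ζ σ : ℂ} (h : |ζ.im| < Real.pi) (h' : |σ.im| < Real.pi) :
    dslope Complex.exp σ ζ ≠ 0 := by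
  rcases eq_or_ne ζ σ with rfl | hne
  · rw [dslope_same, Complex.deriv_exp]
    exact Complex.exp_ne_zero _
  · rw [dslope_of_ne _ hne, slope_def_field]
    exact div_ne_zero (sub_ne_zero.2 fun he => hne (exp_eq_exp_of_abs_im_lt h h' he))
      (sub_ne_zero.2 hne)

theorem expRegularPart_eq (E : ℂ → ℂ) {ζ σ : ℂ} (h : |ζ.im| < Real.pi) (h' : |σ.im| < Real.pi)
    (hne : ζ ≠ σ) : expRegularPart E σ ζ =
      Complex.exp ζ / (Complex.exp σ - Complex.exp ζ) *
        (E ζ - E σ * (1 + Complex.exp σ) / (1 + Complex.exp ζ)) := by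
  have h1 := one_add_exp_ne_zero h
  have h2 : Complex.exp ζ - Complex.exp σ ≠ 0 :=
    sub_ne_zero.2 fun he => hne (exp_eq_exp_of_abs_im_lt h h' he)
  have h3 : Complex.exp σ - Complex.exp ζ ≠ 0 := by
    rw [← neg_sub]; exact neg_ne_zero.2 h2
  have h4 := sub_ne_zero.2 hne
  rw [expRegularPart, dslope_of_ne _ hne, dslope_of_ne _ hne, slope_def_field, slope_def_field]
  field_simp
  ring

theorem differentiableOn_expRegularPart {E : ℂ → ℂ} (hE : Differentiable ℂ E) {σ : ℂ} {θ : ℝ}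
    (hθ : θ < Real.pi) (h' : |σ.im| < Real.pi) :
    DifferentiableOn ℂ (expRegularPart E σ) (im ⁻¹' Icc (-θ) θ) := by
  have hd : ∀ {f : ℂ → ℂ}, Differentiable ℂ f → Differentiable ℂ (dslope f σ) := fun {f} hf =>
    differentiableOn_univ.1 ((Complex.differentiableOn_dslope univ_mem).2 hf.differentiableOn)
  have h1 := hd (f := fun w => E w * (1 + Complex.exp w)) (by fun_prop)
  have h2 := hd Complex.differentiable_exp
  refine DifferentiableOn.neg (DifferentiableOn.div
    (Complex.differentiable_exp.mul h1).differentiableOn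
    (h2.mul (by fun_prop)).differentiableOn fun ζ hζ => ?_)
  have hζ' : |ζ.im| < Real.pi := (abs_le.2 hζ).trans_lt hθ
  exact mul_ne_zero (dslope_exp_ne_zero hζ' h') (one_add_exp_ne_zero hζ')

theorem norm_expRegularPart_le {α θ : ℝ} (h0 : 0 < α) (hθ : Real.pi / 2 < θ) (hπ : θ < Real.pi)
    (hαθ : α * θ < Real.pi / 2) {σ : ℂ} (hσ : |σ.im| < Real.pi) :
    ∃ R M : ℝ, ∀ ζ : ℂ, ζ.im ∈ Icc (-θ) θ → R ≤ |ζ.re| →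
      ‖expRegularPart (fun w => Complex.exp (-Complex.exp (α * w))) σ ζ‖ ≤
        M * Real.exp (-|ζ.re|) := by
  have hc := cos_pos_of_angle h0 hθ hαθ
  set E : ℂ → ℂ := fun w => Complex.exp (-Complex.exp (α * w)) with hE
  set c := Real.cos (α * θ) with hcdef
  set B := ‖E σ * (1 + Complex.exp σ)‖ with hB
  have hS0 : 0 < ‖Complex.exp σ‖ := norm_pos_iff.2 (Complex.exp_ne_zero σ)
  set S := ‖Complex.exp σ‖ with hS
  set A := 2 + 2 * S + 2 / S with hA
  have hAS : 0 < 2 / S := by positivity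
  have hA0 : 0 < A := by positivity
  have hR : 0 < Real.log A := Real.log_pos (by linarith)
  refine ⟨max (Real.log A) (|σ.re| + 1), 2 * Real.exp (2 / (c * α ^ 2)) + 4 * B + 2 / S * (1 + 2 * B),
    fun ζ hζ hζR => ?_⟩
  have hζ' : |ζ.im| < Real.pi := (abs_le.2 hζ).trans_lt hπ
  have hR1 := (le_max_left _ _).trans hζR
  have hne : ζ ≠ σ := by
    rintro rfl
    linarith [(le_max_right _ _).trans hζR]
  have hB0 : 0 ≤ B := norm_nonneg _
  have hEn : ‖E ζ‖ ≤ Real.exp (-(c * Real.exp (α * ζ.re))) := by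
    rw [hE, Complex.norm_exp, Real.exp_le_exp]
    simp only [neg_re, Complex.exp_re, mul_re, ofReal_re, ofReal_im, zero_mul, sub_zero, mul_im,
      add_zero]
    rw [mul_comm c]
    gcongr
    have h1 : |α * ζ.im| ≤ α * θ := by
      rw [abs_mul, abs_of_pos h0]; gcongr; exact abs_le.2 hζ
    rw [hcdef, ← Real.cos_abs (α * ζ.im)]
    exact Real.cos_le_cos_of_nonneg_of_le_pi (abs_nonneg _) (by linarith [Real.pi_pos]) h1
  have hz : ‖Complex.exp ζ‖ = Real.exp ζ.re := Complex.norm_exp ζ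
  have hm1 := norm_sub_norm_le (Complex.exp ζ) (Complex.exp σ)
  have hm2 := norm_sub_norm_le (Complex.exp σ) (Complex.exp ζ)
  have hm3 := norm_sub_norm_le (Complex.exp ζ) (-1)
  have hm4 := norm_sub_norm_le 1 (-Complex.exp ζ)
  rw [sub_neg_eq_add, norm_neg, norm_one, hz] at hm3 hm4
  rw [add_comm] at hm3
  rw [norm_sub_rev, hz, ← hS] at hm1
  rw [hz, ← hS] at hm2
  rw [expRegularPart_eq E hζ' hσ hne, norm_mul, norm_div, hz]
  have hsub : ‖E ζ - E σ * (1 + Complex.exp σ) / (1 + Complex.exp ζ)‖ ≤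
      ‖E ζ‖ + B / ‖1 + Complex.exp ζ‖ := by
    rw [hB, ← norm_div]; exact norm_sub_le _ _
  set P := ‖Complex.exp σ - Complex.exp ζ‖
  set Q := ‖1 + Complex.exp ζ‖
  have hepos := Real.exp_pos ζ.re
  rcases le_total 0 ζ.re with h | h
  · rw [abs_of_nonneg h] at hR1 ⊢
    have hexp : A ≤ Real.exp ζ.re := by rw [← Real.exp_log hA0]; gcongr
    have hP : Real.exp ζ.re / 2 ≤ P := by linarith
    have hQ : Real.exp ζ.re / 2 ≤ Q := by linarith
    have e1 : Real.exp ζ.re / P ≤ 2 := by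
      rw [div_le_iff₀ (by linarith)]; linarith
    have e2 : B / Q ≤ 2 * B * Real.exp (-ζ.re) := by
      rw [div_le_iff₀ (by linarith), Real.exp_neg]
      calc B = 2 * B * (Real.exp ζ.re)⁻¹ * (Real.exp ζ.re / 2) := by field_simp
        _ ≤ _ := by gcongr
    have e3 : ‖E ζ‖ ≤ Real.exp (2 / (c * α ^ 2)) * Real.exp (-ζ.re) := by
      have := exp_neg_mul_exp_add_le hc h0 ζ.re
      rw [abs_of_nonneg h] at this
      refine hEn.trans (le_trans ?_ this)
      gcongr; linarith
    calc _ ≤ 2 * (Real.exp (2 / (c * α ^ 2)) * Real.exp (-ζ.re) + 2 * B * Real.exp (-ζ.re)) := by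
          gcongr
          linarith
      _ = (2 * Real.exp (2 / (c * α ^ 2)) + 4 * B) * Real.exp (-ζ.re) := by ring
      _ ≤ _ := by
          refine mul_le_mul_of_nonneg_right ?_ (Real.exp_pos _).le
          have : 0 ≤ 2 / S * (1 + 2 * B) := by positivity
          linarith
  · rw [abs_of_nonpos h] at hR1 ⊢
    have hexp : Real.exp ζ.re ≤ 1 / A := by
      rw [one_div, ← Real.exp_log hA0, ← Real.exp_neg]; gcongr; linarith
    have h12 : Real.exp ζ.re ≤ 1 / 2 := hexp.trans (by gcongr; linarith)
    have h1S : Real.exp ζ.re ≤ S / 2 := hexp.trans (by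
      rw [div_le_iff₀ hA0, hA]
      have : S / 2 * (2 + 2 * S + 2 / S) = S + S ^ 2 + 1 := by field_simp
      rw [this]; nlinarith)
    have hP : S / 2 ≤ P := by linarith
    have hQ : 1 / 2 ≤ Q := by linarith
    have e1 : Real.exp ζ.re / P ≤ 2 / S * Real.exp ζ.re := by
      rw [div_le_iff₀ (by linarith)]
      calc Real.exp ζ.re = 2 / S * Real.exp ζ.re * (S / 2) := by field_simp
        _ ≤ _ := by gcongr
    have e2 : B / Q ≤ 2 * B := by
      rw [div_le_iff₀ (by linarith)]
      nlinarith
    have e3 : ‖E ζ‖ ≤ 1 := hEn.trans (by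
      rw [Real.exp_le_one_iff]
      have : 0 < c * Real.exp (α * ζ.re) := by positivity
      linarith)
    calc _ ≤ 2 / S * Real.exp ζ.re * (1 + 2 * B) := by
          gcongr
          linarith
      _ = 2 / S * (1 + 2 * B) * Real.exp (- -ζ.re) := by rw [neg_neg]; ring
      _ ≤ _ := by
          refine mul_le_mul_of_nonneg_right ?_ (Real.exp_pos _).le
          have : 0 ≤ 2 * Real.exp (2 / (c * α ^ 2)) + 4 * B := by positivity
          linarith

theorem laplace_stableDensity {α : ℝ} (h0 : 0 < α) (h1 : α < 1) {σ : ℂ}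
    (hσ : |σ.im| < Real.pi / 2) :
    ∫ x in Ioi (0 : ℝ), Complex.exp (-(Complex.exp σ * x)) * stableDensity α 1 x =
      Complex.exp (-Complex.exp (α * σ)) := by
  obtain ⟨θ, hθ, hπ, hαθ⟩ := exists_angle h0 h1
  have hpi := Real.pi_pos
  have hσ' : |σ.im| < Real.pi := by linarith
  have hs : 0 < (Complex.exp σ).re := by
    rw [Complex.exp_re]
    exact mul_pos (Real.exp_pos _) (Real.cos_pos_of_mem_Ioo (abs_lt.1 hσ))
  have hθ0 : 0 < θ := by linarith
  set s := Complex.exp σ with hsdef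
  obtain ⟨iL1, iR1, eq1⟩ := laplace_stableRay h0 hθ hπ hαθ (abs_of_pos hθ0) hs
  obtain ⟨iL2, iR2, eq2⟩ := laplace_stableRay (y := -θ) h0 hθ hπ hαθ
    (by rw [abs_neg, abs_of_pos hθ0]) hs
  set E : ℂ → ℂ := fun w => Complex.exp (-Complex.exp (α * w)) with hE
  obtain ⟨R, M, hM⟩ := norm_expRegularPart_le h0 hθ hπ hαθ hσ'
  obtain ⟨iN, eN⟩ := integral_strip_eq (by linarith : -θ ≤ θ)
    (differentiableOn_expRegularPart (E := E) (by fun_prop) hπ hσ') hM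
  have hEσ : E σ ≠ 0 := Complex.exp_ne_zero _
  have hline : ∀ y : ℝ, |y| = θ → ∀ t : ℝ,
      Complex.exp (t + y * I) * E (t + y * I) / (s - Complex.exp (t + y * I)) -
        expRegularPart E σ (t + y * I) = E σ * (Complex.exp (t + y * I) * (1 + s) /
          ((s - Complex.exp (t + y * I)) * (1 + Complex.exp (t + y * I)))) := by
    intro y hy t
    have him : ((t : ℂ) + y * I).im = y := by simp
    have hlt : |((t : ℂ) + y * I).im| < Real.pi := by rw [him, hy]; exact hπ
    have hne : (t : ℂ) + y * I ≠ σ := by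
      intro h
      rw [h] at him
      rw [him, hy] at hσ
      linarith
    rw [expRegularPart_eq E hlt hσ' hne]
    have n1 := one_add_exp_ne_zero hlt
    have n2 : s - Complex.exp (t + y * I) ≠ 0 :=
      sub_ne_zero.2 fun he => hne (exp_eq_exp_of_abs_im_lt hlt hσ' he.symm)
    rw [← hsdef]
    field_simp
    ring
  have hmain : ∀ y η : ℝ, |y| = θ → Complex.exp (η * I) = -1 → |y - η| < Real.pi →
      Integrable (fun t : ℝ => Complex.exp (t + y * I) * E (t + y * I) /
        (s - Complex.exp (t + y * I))) →
      ∫ t : ℝ, Complex.exp (t + y * I) * E (t + y * I) / (s - Complex.exp (t + y * I)) =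
        (∫ t : ℝ, expRegularPart E σ (t + y * I)) + E σ * (η * I + Complex.log s) := by
    intro y η hy hη hyη hi
    have hN := iN y (abs_le.1 hy.le)
    have hQ : Integrable (fun t : ℝ => Complex.exp (t + y * I) * (1 + s) /
        ((s - Complex.exp (t + y * I)) * (1 + Complex.exp (t + y * I)))) := by
      refine ((hi.sub hN).const_mul (E σ)⁻¹).congr (Eventually.of_forall fun t => ?_)
      simp only [Pi.sub_apply]
      rw [hline y hy t, inv_mul_cancel_left₀ hEσ]
    have hcos : Real.cos y < 0 := by
      rw [← Real.cos_abs, hy]; linarith [cos_neg_of_angle hθ hπ]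
    have hsin : Real.sin y ≠ 0 := by
      have hsθ := Real.sin_pos_of_pos_of_lt_pi hθ0 hπ
      rcases abs_choice y with h | h <;> rw [h] at hy
      · rw [hy]; exact hsθ.ne'
      · rw [show y = -θ by linarith, Real.sin_neg]; exact (neg_lt_zero.2 hsθ).ne
    rw [← integral_exp_line_eq hs hcos (hy.trans_lt hπ) hsin hη hyη hQ, ← integral_const_mul,
      ← integral_add hN (hQ.const_mul _)]
    congr 1
    ext t
    rw [← hline y hy t]
    ring
  have m1 := hmain θ Real.pi (abs_of_pos hθ0) Complex.exp_pi_mul_I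
    (by rw [abs_lt]; constructor <;> linarith) iR1
  have m2 := hmain (-θ) (-Real.pi) (by rw [abs_neg, abs_of_pos hθ0])
    (by rw [ofReal_neg, neg_mul, Complex.exp_neg, Complex.exp_pi_mul_I]; norm_num)
    (by rw [abs_lt]; constructor <;> linarith) iR2
  have hπ0 : (Real.pi : ℂ) ≠ 0 := ofReal_ne_zero.2 hpi.ne'
  calc _ = ∫ x in Ioi (0 : ℝ), (2 * Real.pi * I)⁻¹ * (Complex.exp (-(s * x)) * stableRay α θ x -
        Complex.exp (-(s * x)) * stableRay α (-θ) x) := by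
        refine setIntegral_congr_fun measurableSet_Ioi fun x hx => ?_
        rw [stableDensity_eq_rayDiff h0 h1 hθ hπ.le hx]
        ring
    _ = (2 * Real.pi * I)⁻¹ * (E σ * (2 * Real.pi * I)) := by
        rw [integral_const_mul, integral_sub iL1 iL2, eq1, eq2]
        congr 1
        refine (congrArg₂ (· - ·) m1 m2).trans ?_
        rw [eN]
        push_cast
        ring
    _ = E σ := by field_simp

theorem integral_exp_mul_smul {β : ℝ} (hβ : 0 < β) (F : ℝ → ℂ) :
    ∫ a : ℝ, (β * Real.exp (β * a)) • F (Real.exp (β * a)) = ∫ r in Ioi (0 : ℝ), F r := by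
  rw [integral_Ioi_eq_integral_exp one_pos]
  simp only [one_mul]
  have := Measure.integral_comp_mul_left (fun b : ℝ => Real.exp b • F (Real.exp b)) β
  simp only [mul_smul, integral_smul, this]
  rw [abs_of_pos (inv_pos.2 hβ), smul_smul, mul_inv_cancel₀ hβ.ne', one_smul]

theorem stableRay_mul_exp_neg (β y x a : ℝ) :
    stableRay β y (x * Real.exp (-a) : ℝ) =
      Real.exp a * ∫ t : ℝ, Complex.exp (x * Complex.exp (t + y * I) -
        Real.exp (β * a) * Complex.exp (β * (t + y * I)) + (t + y * I)) := by
  rw [stableRay, ← integral_add_right_eq_self _ a, ← integral_const_mul]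
  congr 1
  ext t
  rw [stableKernel]
  push_cast
  rw [← Complex.exp_add, ← Complex.exp_add, mul_assoc, ← Complex.exp_add]
  congr 1
  rw [show (-a : ℂ) + (t + a + y * I) = t + y * I by ring,
    show (β : ℂ) * a + β * (t + y * I) = β * (t + a + y * I) by ring]
  ring

theorem powDensity_exp (β : ℝ) (f : ℝ → ℝ) (a : ℝ) : powDensity β f (Real.exp a) =
    β * Real.exp (β * a) * f (Real.exp (β * a)) * Real.exp (-a) := by
  rw [powDensity, ← Real.exp_mul, ← Real.exp_mul, mul_comm a β, show a * (β - 1) = β * a + -a by ring,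
    Real.exp_add]
  ring

theorem integrable_exp_neg_mul_exp_add_mul {c δ : ℝ} (hc : 0 < c) (hδ : 0 < δ) :
    Integrable fun t : ℝ => Real.exp (-(c * Real.exp t) + δ * t) := by
  refine ((integrable_exp_neg_mul_exp_add hc (inv_pos.2 hδ)).comp_mul_left' hδ.ne').congr
    (Eventually.of_forall fun t => ?_)
  simp only [inv_mul_cancel_left₀ hδ.ne']

theorem stableRay_mulConv {α β θ y x : ℝ} (hα0 : 0 < α) (hα1 : α < 1) (hβ0 : 0 < β) (hβ1 : β < 1)
    (hθ : Real.pi / 2 < θ) (hπ : θ < Real.pi) (hβθ : β * θ < Real.pi / 2) (hy : |y| = θ)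
    (hx : 0 < x) :
    Integrable (fun a : ℝ => stableRay β y (x * Real.exp (-a) : ℝ) *
      (powDensity β (stableDensity α 1) (Real.exp a) : ℂ)) ∧
    ∫ a : ℝ, stableRay β y (x * Real.exp (-a) : ℝ) *
      (powDensity β (stableDensity α 1) (Real.exp a) : ℂ) = stableRay (α * β) y x := by
  have hc := cos_pos_of_angle hβ0 hθ hβθ
  have hκ := cos_neg_of_angle hθ hπ
  have hcy : Real.cos (β * y) = Real.cos (β * θ) := by
    rw [← Real.cos_abs (β * y), abs_mul, abs_of_pos hβ0, hy]
  have hcy2 : Real.cos y = Real.cos θ := by rw [← Real.cos_abs y, hy]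
  obtain ⟨C, hC0, hC⟩ := exists_abs_stableDensity_le hα0 hα1
  have hcontg : Continuous fun a : ℝ => stableDensity α 1 (Real.exp (β * a)) :=
    (continuousOn_stableDensity hα0 hα1).comp_continuous (by fun_prop) fun a => Real.exp_pos _
  let H : ℝ → ℝ → ℂ := fun a t => Complex.exp (x * Complex.exp (t + y * I) -
    Real.exp (β * a) * Complex.exp (β * (t + y * I)) + (t + y * I)) *
    ((β * Real.exp (β * a) * stableDensity α 1 (Real.exp (β * a)) : ℝ) : ℂ)
  have hH : ∀ a t : ℝ, ‖H a t‖ = Real.exp (-(x * -Real.cos θ * Real.exp t) -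
      Real.cos (β * θ) * (Real.exp (β * a) * Real.exp (β * t)) + t) *
      (β * Real.exp (β * a) * |stableDensity α 1 (Real.exp (β * a))|) := by
    intro a t
    have hw : ‖((β * Real.exp (β * a) * stableDensity α 1 (Real.exp (β * a)) : ℝ) : ℂ)‖ =
        β * Real.exp (β * a) * |stableDensity α 1 (Real.exp (β * a))| := by
      rw [Complex.norm_real, Real.norm_eq_abs, abs_mul, abs_of_pos (by positivity)]
    simp only [H]
    rw [norm_mul, hw, Complex.norm_exp]
    congr 2
    have e1 : ((β : ℂ) * (t + y * I)) = ((β * t : ℝ) : ℂ) + ((β * y : ℝ) : ℂ) * I := by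
      push_cast; ring
    rw [e1, add_re, sub_re, re_ofReal_mul, re_ofReal_mul, re_exp_add_mul_I, re_exp_add_mul_I, hcy,
      hcy2]
    simp
    ring
  have hprod : Integrable (Function.uncurry H) (volume.prod volume) := by
    have hi1 := (integrable_exp_neg_mul_abs hβ0).const_mul (β * C)
    have hi2 := (integrable_exp_neg_mul_exp_add_mul (mul_pos hx hκ) one_pos).add
      ((integrable_exp_neg_mul_exp_add_mul (mul_pos hx hκ) (sub_pos.2 hβ1)).const_mul
        (Real.cos (β * θ))⁻¹)
    refine (hi1.mul_prod hi2).mono' ?_ (Eventually.of_forall fun p => ?_)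
    · refine Continuous.aestronglyMeasurable ?_
      simp only [Function.uncurry_def, H]
      have := hcontg.comp (continuous_fst (X := ℝ) (Y := ℝ))
      simp only [Function.comp_def] at this
      fun_prop
    · obtain ⟨a, t⟩ := p
      simp only [Function.uncurry_apply_pair, Pi.add_apply]
      rw [hH]
      obtain ⟨hb1, hb2⟩ := hC _ (Real.exp_pos (β * a))
      have hexp1 : 0 < x * -Real.cos θ * Real.exp t := by positivity
      have hu : 0 < Real.cos (β * θ) * (Real.exp (β * a) * Real.exp (β * t)) := by positivity
      have hnn : 0 ≤ (Real.cos (β * θ))⁻¹ *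
          Real.exp (-(x * -Real.cos θ * Real.exp t) + (1 - β) * t) := by positivity
      have hnn2 : 0 ≤ Real.exp (-(x * -Real.cos θ * Real.exp t) + 1 * t) := by positivity
      rcases le_total 0 a with h | h
      · have e1 : Real.exp (β * a) * |stableDensity α 1 (Real.exp (β * a))| ≤ C := by
          rwa [le_div_iff₀ (Real.exp_pos _), mul_comm] at hb2
        have e2 : Real.exp (-(Real.cos (β * θ) * (Real.exp (β * a) * Real.exp (β * t)))) ≤
            (Real.cos (β * θ))⁻¹ * Real.exp (-(β * a)) * Real.exp (-(β * t)) := by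
          rw [Real.exp_neg, Real.exp_neg, Real.exp_neg, ← mul_inv, ← mul_inv, mul_assoc]
          gcongr
          linarith [Real.add_one_le_exp
            (Real.cos (β * θ) * (Real.exp (β * a) * Real.exp (β * t)))]
        rw [abs_of_nonneg h]
        calc _ = Real.exp (-(Real.cos (β * θ) * (Real.exp (β * a) * Real.exp (β * t)))) *
              Real.exp (-(x * -Real.cos θ * Real.exp t) + t) *
              (β * (Real.exp (β * a) * |stableDensity α 1 (Real.exp (β * a))|)) := by
              rw [mul_assoc β, ← Real.exp_add (-(Real.cos _ * _))]
              congr 2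
              ring
          _ ≤ ((Real.cos (β * θ))⁻¹ * Real.exp (-(β * a)) * Real.exp (-(β * t))) *
              Real.exp (-(x * -Real.cos θ * Real.exp t) + t) * (β * C) := by gcongr
          _ = β * C * Real.exp (-(β * a)) * ((Real.cos (β * θ))⁻¹ *
              Real.exp (-(x * -Real.cos θ * Real.exp t) + (1 - β) * t)) := by
              rw [show -(x * -Real.cos θ * Real.exp t) + (1 - β) * t =
                -(β * t) + (-(x * -Real.cos θ * Real.exp t) + t) by ring, Real.exp_add (-(β * t))]
              ring
          _ ≤ _ := by gcongr; linarith
      · rw [abs_of_nonpos h]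
        calc _ ≤ Real.exp (-(x * -Real.cos θ * Real.exp t) + 1 * t) *
              (β * Real.exp (β * a) * C) := by
              refine mul_le_mul (Real.exp_le_exp.2 (by linarith)) (by gcongr) (by positivity)
                (by positivity)
          _ = β * C * Real.exp (-(β * -a)) * Real.exp (-(x * -Real.cos θ * Real.exp t) + 1 * t) := by
              rw [show -(β * -a) = β * a by ring]; ring
          _ ≤ _ := by gcongr; linarith
  have hintg : ∀ a : ℝ, stableRay β y (x * Real.exp (-a) : ℝ) *
      (powDensity β (stableDensity α 1) (Real.exp a) : ℂ) = ∫ t : ℝ, H a t := by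
    intro a
    simp only [H]
    rw [integral_mul_const, stableRay_mul_exp_neg, powDensity_exp]
    have : (Real.exp a : ℂ) * Real.exp (-a) = 1 := by
      rw [← ofReal_mul, ← Real.exp_add]; simp
    rw [ofReal_mul (_ * _) (Real.exp (-a))]
    linear_combination (∫ t : ℝ, Complex.exp (x * Complex.exp (t + y * I) -
        Real.exp (β * a) * Complex.exp (β * (t + y * I)) + (t + y * I))) *
        ((β * Real.exp (β * a) * stableDensity α 1 (Real.exp (β * a)) : ℝ) : ℂ) * this
  have hinner : ∀ t : ℝ, ∫ a : ℝ, H a t = stableKernel (α * β) x (t + y * I) := by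
    intro t
    have hL := laplace_stableDensity hα0 hα1 (σ := β * (t + y * I))
      (by simpa [abs_mul, abs_of_pos hβ0, hy] using hβθ)
    rw [← integral_exp_mul_smul hβ0] at hL
    calc _ = ∫ a : ℝ, Complex.exp (x * Complex.exp (t + y * I) + (t + y * I)) *
          ((β * Real.exp (β * a)) • (Complex.exp (-(Complex.exp (β * (t + y * I)) *
            (Real.exp (β * a) : ℝ))) * stableDensity α 1 (Real.exp (β * a)))) := by
          congr 1
          ext a
          simp only [H, real_smul]
          rw [ofReal_mul (β * _)]
          rw [show (x : ℂ) * Complex.exp (t + y * I) - Real.exp (β * a) *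
            Complex.exp (β * (t + y * I)) + (t + y * I) =
            (x * Complex.exp (t + y * I) + (t + y * I)) +
              -(Complex.exp (β * (t + y * I)) * (Real.exp (β * a) : ℝ)) by ring, Complex.exp_add]
          ring
      _ = _ := by
          rw [integral_const_mul, hL, stableKernel, ← Complex.exp_add]
          congr 1
          push_cast
          rw [mul_assoc (α : ℂ)]
          ring
  refine ⟨hprod.integral_prod_left.congr (Eventually.of_forall fun a => (hintg a).symm), ?_⟩
  rw [integral_congr_ae (Eventually.of_forall hintg), integral_integral_swap hprod, stableRay]
  exact integral_congr_ae (Eventually.of_forall hinner)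

/-- If `X`, `Y` are independent positive stable variables of indices `α`, `β`, then
`X ^ (1 / β) * Y` is positive stable of index `α * β`. -/
theorem stableDensity_mul_eq_mulConv {α β x : ℝ} (hα0 : 0 < α) (hα1 : α < 1) (hβ0 : 0 < β)
    (hβ1 : β < 1) (hx : 0 < x) :
    Integrable (fun a : ℝ => stableDensity β 1 (x * Real.exp (-a)) *
      powDensity β (stableDensity α 1) (Real.exp a)) ∧
    stableDensity (α * β) 1 x = mulConv (stableDensity β 1) (powDensity β (stableDensity α 1)) x := by
  obtain ⟨θ, hθ, hπ, hβθ⟩ := exists_angle hβ0 hβ1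
  have hθ0 : 0 < θ := by linarith [Real.pi_pos]
  obtain ⟨i1, e1⟩ := stableRay_mulConv hα0 hα1 hβ0 hβ1 hθ hπ hβθ (abs_of_pos hθ0) hx
  obtain ⟨i2, e2⟩ := stableRay_mulConv (y := -θ) hα0 hα1 hβ0 hβ1 hθ hπ hβθ
    (by rw [abs_neg, abs_of_pos hθ0]) hx
  have hpt : ∀ a : ℝ, ((stableDensity β 1 (x * Real.exp (-a)) *
      powDensity β (stableDensity α 1) (Real.exp a) : ℝ) : ℂ) =
      (2 * Real.pi * I)⁻¹ * (stableRay β θ (x * Real.exp (-a) : ℝ) *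
      (powDensity β (stableDensity α 1) (Real.exp a) : ℂ) -
      stableRay β (-θ) (x * Real.exp (-a) : ℝ) *
      (powDensity β (stableDensity α 1) (Real.exp a) : ℂ)) := by
    intro a
    rw [ofReal_mul, stableDensity_eq_rayDiff hβ0 hβ1 hθ hπ.le (by positivity)]
    ring
  refine ⟨?_, ?_⟩
  · have := ((i1.sub i2).const_mul (2 * Real.pi * I)⁻¹).re
    refine this.congr (Eventually.of_forall fun a => ?_)
    simp only [Pi.sub_apply]
    rw [← hpt a]
    exact ofReal_re _
  · rw [← ofReal_inj, mulConv, ← integral_complex_ofReal,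
      integral_congr_ae (Eventually.of_forall hpt), integral_const_mul, integral_sub i1 i2, e1, e2]
    exact stableDensity_eq_rayDiff (mul_pos hα0 hβ0) (by nlinarith) hθ hπ.le hx

theorem integrable_stableDensity_kernel {α β u v s : ℝ} (hα0 : 0 < α) (hα1 : α < 1) (hβ0 : 0 < β)
    (hβ1 : β < 1) (hu : 0 < u) (hv : 0 < v) (hs : 0 < s) : Integrable (fun t : ℝ =>
      stableDensity β 1 (u * (v * Real.exp (-t))) * stableDensity β 1 (u / (v * Real.exp (-t))) *
        (powDensity β (stableDensity α 1) (s * Real.exp t) *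
          powDensity β (stableDensity α 1) (s / Real.exp t))) := by
  obtain ⟨C, hC0, hC⟩ := exists_abs_stableDensity_le hβ0 hβ1
  obtain ⟨D, hD0, hD⟩ := exists_abs_stableDensity_le hα0 hα1
  have hcβ := continuousOn_stableDensity hβ0 hβ1
  have hcα := continuousOn_stableDensity hα0 hα1
  have hpow : ∀ t : ℝ, powDensity β (stableDensity α 1) (s * Real.exp t) *
      powDensity β (stableDensity α 1) (s / Real.exp t) = (β * s ^ (β - 1)) ^ 2 *
      (stableDensity α 1 (s ^ β * Real.exp (t * β)) * stableDensity α 1 (s ^ β / Real.exp (t * β))) :=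
    fun t => by rw [powDensity_mul_powDensity β _ hs (Real.exp_pos t), ← Real.exp_mul]
  simp only [hpow]
  have hsβ : 0 < s ^ β := Real.rpow_pos_of_pos hs β
  refine ((integrable_exp_neg_mul_abs one_pos).const_mul
    (C * (C * (v / u + 1 / (u * v))) * ((β * s ^ (β - 1)) ^ 2 * (D * D)))).mono' ?_
    (Eventually.of_forall fun t => ?_)
  · refine Continuous.aestronglyMeasurable ?_
    have c1 : Continuous fun t : ℝ => u / (v * Real.exp (-t)) :=
      continuous_const.div (by fun_prop) fun t => by positivity
    have c2 : Continuous fun t : ℝ => s ^ β / Real.exp (t * β) :=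
      continuous_const.div (by fun_prop) fun t => by positivity
    exact ((hcβ.comp_continuous (by fun_prop) fun t => mem_Ioi.2 (by positivity)).mul
      (hcβ.comp_continuous c1 fun t => mem_Ioi.2 (by positivity))).mul (continuous_const.mul
      ((hcα.comp_continuous (by fun_prop) fun t => mem_Ioi.2 (by positivity)).mul
      (hcα.comp_continuous c2 fun t => mem_Ioi.2 (by positivity))))
  · obtain ⟨a1, a2⟩ := hC (u * (v * Real.exp (-t))) (by positivity)
    obtain ⟨b1, b2⟩ := hC (u / (v * Real.exp (-t))) (by positivity)
    have d1 := (hD (s ^ β * Real.exp (t * β)) (by positivity)).1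
    have d2 := (hD (s ^ β / Real.exp (t * β)) (by positivity)).1
    have hfirst : |stableDensity β 1 (u * (v * Real.exp (-t)))| *
        |stableDensity β 1 (u / (v * Real.exp (-t)))| ≤
        C * (C * (v / u + 1 / (u * v))) * Real.exp (-(1 * |t|)) := by
      rcases le_total 0 t with h | h
      · rw [abs_of_nonneg h, one_mul]
        calc _ ≤ C * (C / (u / (v * Real.exp (-t)))) := by gcongr
          _ = C * (C * (v / u)) * Real.exp (-t) := by field_simp
          _ ≤ _ := by gcongr; exact le_add_of_nonneg_right (by positivity)
      · rw [abs_of_nonpos h, one_mul, neg_neg]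
        calc _ ≤ (C / (u * (v * Real.exp (-t)))) * C := by gcongr
          _ = C * (C * (1 / (u * v))) * Real.exp t := by
              rw [Real.exp_neg]; field_simp
          _ ≤ _ := by gcongr; exact le_add_of_nonneg_left (by positivity)
    rw [norm_mul, norm_mul, norm_mul, norm_mul, Real.norm_of_nonneg (by positivity :
      0 ≤ (β * s ^ (β - 1)) ^ 2)]
    simp only [Real.norm_eq_abs]
    calc _ ≤ (C * (C * (v / u + 1 / (u * v))) * Real.exp (-(1 * |t|))) *
          ((β * s ^ (β - 1)) ^ 2 * (D * D)) := by gcongr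
      _ = _ := by ring

theorem altDiff_stableDensity_mul {α β : ℝ} (hα0 : 0 < α) (hα1 : α < 1) (hβ0 : 0 < β) (hβ1 : β < 1)
    (h1 : HCM (stableDensity α 1)) (h2 : HCM (stableDensity β 1)) {u : ℝ} (hu : 0 < u) (n : ℕ) :
    AltDiff 2 n (fun w => stableDensity (α * β) 1 (u * joukowskiInv w) *
      stableDensity (α * β) 1 (u / joukowskiInv w)) := by
  refine (altDiff_mulConv h2.boundedHCM (h1.boundedHCM_powDensity hβ0 hβ1)
    (fun x hx => (stableDensity_mul_eq_mulConv hα0 hα1 hβ0 hβ1 hx).1)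
    (fun u v s hu hv hs => integrable_stableDensity_kernel hα0 hα1 hβ0 hβ1 hu hv hs)
    hu n).congr fun w (hw : 2 < w) => ?_
  have hV := joukowskiInv_pos hw
  beta_reduce
  rw [(stableDensity_mul_eq_mulConv hα0 hα1 hβ0 hβ1 (by positivity)).2,
    (stableDensity_mul_eq_mulConv hα0 hα1 hβ0 hβ1 (by positivity)).2]

theorem isOpen_re_pos : IsOpen {z : ℂ | 0 < z.re} := isOpen_lt continuous_const continuous_re

theorem DifferentiableOn.iteratedDeriv_complex {F : ℂ → ℂ} {U : Set ℂ} (hU : IsOpen U)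
    (hF : DifferentiableOn ℂ F U) (n : ℕ) : DifferentiableOn ℂ (iteratedDeriv n F) U := by
  induction n with
  | zero => simpa using hF
  | succ n ih => rw [iteratedDeriv_succ]; exact ih.deriv hU

theorem iteratedDeriv_re_ofReal {F : ℂ → ℂ} (hF : DifferentiableOn ℂ F {z | 0 < z.re}) (n : ℕ)
    {x : ℝ} (hx : 0 < x) :
    iteratedDeriv n (fun x : ℝ => (F x).re) x = (iteratedDeriv n F x).re := by
  induction n generalizing x with
  | zero => simp
  | succ n ih =>
    have he : iteratedDeriv n (fun x : ℝ => (F x).re) =ᶠ[𝓝 x]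
        fun x : ℝ => (iteratedDeriv n F x).re := by
      filter_upwards [lt_mem_nhds hx] with y hy using ih hy
    rw [iteratedDeriv_succ, he.deriv_eq, iteratedDeriv_succ]
    have hd := (hF.iteratedDeriv_complex isOpen_re_pos n).differentiableAt
      (isOpen_re_pos.mem_nhds (x := (x : ℂ)) (by simpa using hx))
    exact hd.hasDerivAt.real_of_complex.deriv

theorem contDiffOn_re_ofReal {F : ℂ → ℂ} (hF : DifferentiableOn ℂ F {z | 0 < z.re}) :
    ContDiffOn ℝ ∞ (fun x : ℝ => (F x).re) (Ioi 0) :=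
  reCLM.contDiff.comp_contDiffOn (((hF.contDiffOn (n := ∞) isOpen_re_pos).restrict_scalars ℝ).comp
    ofRealCLM.contDiff.contDiffOn fun x hx => by simpa using hx)

/-- A function holomorphic in the right half-plane which is completely monotone far out on the
real axis is completely monotone on the positive half-line. -/
theorem CMOn.of_differentiableOn {F : ℂ → ℂ} (hF : DifferentiableOn ℂ F {z | 0 < z.re}) {a : ℝ}
    (h : CMOn a (fun x : ℝ => (F x).re)) : CMOn 0 (fun x : ℝ => (F x).re) := by
  refine ⟨contDiffOn_re_ofReal hF, fun n x hx => ?_⟩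
  set c : ℝ := max a x + 1 with hc
  have hac : a < c := (le_max_left a x).trans_lt (lt_add_one _)
  have hxc : x < c := (le_max_right a x).trans_lt (lt_add_one _)
  have hc0 : 0 < c := hx.trans hxc
  have hball : Metric.ball (c : ℂ) c ⊆ {z | 0 < z.re} := fun z hz => by
    have h1 : |(z - c).re| < c :=
      (abs_re_le_norm _).trans_lt (by rwa [Metric.mem_ball, dist_eq_norm] at hz)
    have h2 := (abs_lt.1 h1).1
    rw [sub_re, ofReal_re] at h2
    exact show 0 < z.re by linarith
  have hx' : (x : ℂ) ∈ Metric.ball (c : ℂ) c := by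
    rw [Metric.mem_ball, dist_eq_norm, ← ofReal_sub, norm_real, Real.norm_eq_abs, abs_lt]
    constructor <;> linarith
  have hs := Complex.hasSum_taylorSeries_on_ball
    ((hF.iteratedDeriv_complex isOpen_re_pos n).mono hball) hx'
  have hs' := (reCLM.hasSum hs).mul_left ((-1 : ℝ) ^ n)
  rw [iteratedDeriv_re_ofReal hF n hx]
  refine hs'.nonneg fun k => ?_
  have hk := h.2 (k + n) c hac
  rw [iteratedDeriv_re_ofReal hF _ hc0] at hk
  have hit : iteratedDeriv k (iteratedDeriv n F) c = iteratedDeriv (k + n) F c := by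
    simp only [iteratedDeriv_eq_iterate, Function.iterate_add_apply]
  have e : ((k.factorial : ℂ)⁻¹ • ((x : ℂ) - c) ^ k • iteratedDeriv k (iteratedDeriv n F) c) =
      (((k.factorial : ℝ)⁻¹ * (x - c) ^ k : ℝ) : ℂ) * iteratedDeriv (k + n) F c := by
    rw [hit]; push_cast; simp only [smul_eq_mul]; ring
  simp only [reCLM_apply]
  rw [e, re_ofReal_mul]
  have e2 : (-1 : ℝ) ^ n * ((k.factorial : ℝ)⁻¹ * (x - c) ^ k * (iteratedDeriv (k + n) F c).re) =
      (k.factorial : ℝ)⁻¹ * (c - x) ^ k * ((-1) ^ (k + n) * (iteratedDeriv (k + n) F c).re) := by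
    rw [show x - c = -1 * (c - x) by ring, mul_pow, pow_add]; ring
  rw [e2]
  have : 0 ≤ c - x := by linarith
  positivity

theorem re_add_inv_pos_iff {z : ℂ} : 0 < (z + z⁻¹).re ↔ 0 < z.re := by
  have e : (z + z⁻¹).re = z.re * (1 + (normSq z)⁻¹) := by
    rw [add_re, inv_re]; ring
  rw [e, mul_pos_iff_of_pos_right]
  have := inv_nonneg.2 (normSq_nonneg z)
  linarith

/-- A holomorphic function of `z` in the right half-plane which is invariant under inversion is a
holomorphic function of `z + z⁻¹`. -/
theorem exists_differentiableOn_add_inv {K : ℂ → ℂ} (hK : DifferentiableOn ℂ K {z | 0 < z.re})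
    (hinv : ∀ z, K z⁻¹ = K z) : ∃ F : ℂ → ℂ, DifferentiableOn ℂ F {z | 0 < z.re} ∧
      ∀ z, 0 < z.re → F (z + z⁻¹) = K z := by
  set V : ℂ → ℂ := fun w => (w + (w ^ 2 - 4) ^ ((2 : ℕ) : ℂ)⁻¹) / 2 with hV
  set W : ℂ → ℂ := fun w => (w + I * (4 - w ^ 2) ^ ((2 : ℕ) : ℂ)⁻¹) / 2 with hW
  have hVV : ∀ w, V w * (w - V w) = 1 := fun w => by
    have := cpow_nat_inv_pow (w ^ 2 - 4) two_ne_zero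
    simp only [hV]
    linear_combination (-1 / 4) * this
  have hWW : ∀ w, W w * (w - W w) = 1 := fun w => by
    have := cpow_nat_inv_pow (4 - w ^ 2) two_ne_zero
    simp only [hW]
    linear_combination (1 / 4) * this - (1 / 4) * ((4 - w ^ 2) ^ ((2 : ℕ) : ℂ)⁻¹) ^ 2 * I_sq
  have hroot : ∀ {w z : ℂ}, z * (w - z) = 1 → K z = K (V w) := fun {w z} hz => by
    have h0 : (z - V w) * (z - (w - V w)) = 0 := by linear_combination hVV w - hz
    rcases mul_eq_zero.1 h0 with h | h
    · rw [sub_eq_zero.1 h]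
    · rw [sub_eq_zero.1 h, eq_inv_of_mul_eq_one_right (hVV w), hinv]
  have hpos : ∀ {w z : ℂ}, 0 < w.re → z * (w - z) = 1 → 0 < z.re := fun {w z} hw hz => by
    rw [← re_add_inv_pos_iff, ← eq_inv_of_mul_eq_one_right hz]
    simpa using hw
  have hopen := isOpen_re_pos
  refine ⟨fun w => K (V w), ?_, fun z hz => (hroot ?_).symm⟩
  · have h2 : (2 : ℂ) ∈ {z : ℂ | 0 < z.re} := by simp
    refine (differentiableOn_compl_singleton_and_continuousAt_iff (hopen.mem_nhds h2)).1 ⟨?_, ?_⟩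
    · rintro w ⟨hw, hw2⟩
      have hKV := hK.differentiableAt (hopen.mem_nhds (hpos hw (hVV w)))
      have hKW := hK.differentiableAt (hopen.mem_nhds (hpos hw (hWW w)))
      refine DifferentiableAt.differentiableWithinAt ?_
      by_cases hsl : w ^ 2 - 4 ∈ slitPlane
      · have hs : DifferentiableAt ℂ (fun w : ℂ => w ^ 2 - 4) w := by fun_prop
        exact hKV.comp w ((differentiableAt_fun_id.fun_add (hs.cpow_const hsl)).div_const 2)
      · have hsl' : 4 - w ^ 2 ∈ slitPlane := by
          rw [mem_slitPlane_iff, not_or, not_lt, not_not] at hsl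
          rw [mem_slitPlane_iff, ← neg_sub, neg_re, neg_im]
          by_contra! h
          have : w ^ 2 - 4 = 0 := Complex.ext (le_antisymm hsl.1 (by simpa using h.1)) hsl.2
          have h0 : (w - 2) * (w + 2) = 0 := by linear_combination this
          rcases mul_eq_zero.1 h0 with h | h
          · exact hw2 (sub_eq_zero.1 h)
          · have := congrArg re h
            simp only [add_re, re_ofNat, zero_re] at this
            have hw' : 0 < w.re := hw
            linarith
        have he : (fun w => K (V w)) = fun w => K (W w) := funext fun w => (hroot (hWW w)).symm
        rw [he]
        have hs : DifferentiableAt ℂ (fun w : ℂ => 4 - w ^ 2) w := by fun_prop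
        exact hKW.comp w ((differentiableAt_fun_id.fun_add
          ((hs.cpow_const hsl').const_mul I)).div_const 2)
    · have hKV := (hK.differentiableAt (hopen.mem_nhds (hpos h2 (hVV 2)))).continuousAt
      refine ContinuousAt.comp (f := V) hKV ?_
      have hc : ContinuousAt (fun z : ℂ => z ^ ((2 : ℕ) : ℂ)⁻¹) ((2 : ℂ) ^ 2 - 4) :=
        continuousAt_cpow_const_of_re_pos (by norm_num) (by norm_num)
      exact (continuousAt_id.add (ContinuousAt.comp (f := fun w : ℂ => w ^ 2 - 4) hc
        (by fun_prop))).div_const 2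
  · have : z ≠ 0 := fun h => by simp [h] at hz
    field_simp
    ring

/-- If the alternating differences of `w ↦ g (u V) g (u / V)`, `V + 1 / V = w`, are nonnegative
on `(2, ∞)` and `g` extends holomorphically to the right half-plane, then `g` is HCM. -/
theorem HCM.of_altDiff {g : ℝ → ℝ} {G : ℂ → ℂ} (hG : DifferentiableOn ℂ G {z | 0 < z.re})
    (hg : ∀ x : ℝ, 0 < x → G x = g x)
    (h : ∀ u : ℝ, 0 < u → ∀ n, AltDiff 2 n (fun w => g (u * joukowskiInv w) *
      g (u / joukowskiInv w))) : HCM g := by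
  intro u hu
  have hpos : ∀ z : ℂ, 0 < z.re → 0 < (z⁻¹).re := fun z hz => by
    have : 0 < normSq z := normSq_pos.2 fun h => by simp [h] at hz
    rw [inv_re]
    positivity
  obtain ⟨F, hF, hFK⟩ := exists_differentiableOn_add_inv (K := fun z => G (u * z) * G (u * z⁻¹))
    (by
      have hm : ∀ z : ℂ, 0 < z.re → (0 : ℝ) < ((u : ℂ) * z).re := fun z hz => by
        rw [re_ofReal_mul]; positivity
      refine (hG.comp (by fun_prop) fun z hz => hm z hz).mul
        (hG.comp (g := G) (f := fun z => (u : ℂ) * z⁻¹) ?_ fun z hz => hm _ (hpos z hz))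
      refine (differentiableOn_inv.mono fun z hz h0 => ?_).const_mul _
      have hz' : 0 < z.re := hz
      rw [show z = 0 from h0, zero_re] at hz'
      exact lt_irrefl _ hz')
    (fun z => by simp only [inv_inv]; ring)
  have hFv : ∀ v : ℝ, 0 < v → (F ((v + 1 / v : ℝ) : ℂ)).re = g (u * v) * g (u / v) := by
    intro v hv
    have := hFK v (by simpa using hv)
    rw [← ofReal_inv, ← ofReal_add, ← ofReal_mul, ← ofReal_mul, hg _ (by positivity),
      hg _ (by positivity), ← ofReal_mul] at this
    rw [one_div, this, ofReal_re, div_eq_mul_inv]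
  refine ⟨fun x : ℝ => (F x).re, CMOn.of_differentiableOn hF (a := 2) (CMOn.of_altDiff
    ((contDiffOn_re_ofReal hF).mono (Ioi_subset_Ioi (by norm_num))) fun n =>
    (h u hu n).congr fun w hw => ?_), fun v hv => (hFv v hv).symm⟩
  beta_reduce
  rw [← hFv _ (joukowskiInv_pos hw), joukowskiInv_add_inv hw]

/-- The set of `α ∈ (0,1)` such that `g_α` is HCM is a multiplicative
semigroup: if `g_α` and `g_β` are HCM then so is `g_{αβ}`. -/
theorem stableDensity_HCM_semigroup (α β : ℝ) (hα : α ∈ Set.Ioo (0:ℝ) 1)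
    (hβ : β ∈ Set.Ioo (0:ℝ) 1)
    (h1 : HCM (stableDensity α 1)) (h2 : HCM (stableDensity β 1)) :
    HCM (stableDensity (α * β) 1) := by
  have h0 : 0 < α * β := mul_pos hα.1 hβ.1
  have h1' : α * β < 1 := mul_lt_one_of_nonneg_of_lt_one_left hα.1.le hα.2 hβ.2.le
  exact HCM.of_altDiff (differentiableOn_stableExt h0 h1')
    (fun x hx => stableExt_ofReal h0 h1' hx)
    fun u hu n => altDiff_stableDensity_mul hα.1 hα.2 hβ.1 hβ.2 h1 h2 hu n
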